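/- Let (u, p) be a weak solution of the HHMO model. (a) If η ≥ α and t₀ ≥ 0 are such that u(η√t, t) ≤ u* for all t ≥ t₀, then there exists z ≥ 0 such that u(x,t) < u* and p(x,t) = 0 for all (x,t) in the interior of D_{η,z}. (b) If moreover η = α and the strict inequality u(α√t, t) < u* holds for all t ≥ t₀, then there exists z ≥ 0 such that u(x,t) < u* and p(x,t) = 0 for all x ≥ z and all t ≥ 0. -/

import Mathlib

open MeasureTheory Filter Set

noncomputable section

/-- The precipitation-free self-similar solution `ψ(x,t)`. -/
def psi (α β x t : ℝ) : ℝ :=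
  if 0 < t then
    (α * β / 2) * Real.exp (α ^ 2 / 4) *
      ∫ ζ in Set.Ioi (max (|x| / Real.sqrt t) α), Real.exp (-ζ ^ 2 / 4)
  else 0

/-- The profile `Ψ(η)` in similarity coordinates. -/
def PsiP (α β η : ℝ) : ℝ :=
  (α * β / 2) * Real.exp (α ^ 2 / 4) * ∫ ζ in Set.Ioi (max η α), Real.exp (-ζ ^ 2 / 4)

/-- Regularity of a weak solution: `w` is the spatial derivative of `u - ψ`;
both are continuous on `ℝ × [0,∞)` and bounded on `ℝ × [0,T]` for every `T > 0`. -/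
def AuxReg (α β : ℝ) (u w : ℝ → ℝ → ℝ) : Prop :=
  (∀ t ∈ Set.Ici (0:ℝ), ∀ x : ℝ, HasDerivAt (fun y => u y t - psi α β y t) (w x t) x) ∧
  ContinuousOn (fun q : ℝ × ℝ => u q.1 q.2 - psi α β q.1 q.2) (Set.univ ×ˢ Set.Ici 0) ∧
  ContinuousOn (fun q : ℝ × ℝ => w q.1 q.2) (Set.univ ×ˢ Set.Ici 0) ∧
  ∀ T > (0:ℝ), ∃ C : ℝ, ∀ x : ℝ, ∀ t ∈ Set.Icc (0:ℝ) T,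
    |u x t - psi α β x t| ≤ C ∧ |w x t| ≤ C

/-- A test function of class `C^{1,1}(ℝ × [0,T])`, vanishing for large `|x|` and at `t = T`,
together with its partial derivatives `φt`, `φx`. -/
def IsTestFun (T : ℝ) (φ φt φx : ℝ → ℝ → ℝ) : Prop :=
  (∀ x : ℝ, ∀ t ∈ Set.Icc (0:ℝ) T,
    HasDerivWithinAt (fun s => φ x s) (φt x t) (Set.Icc 0 T) t) ∧
  (∀ x : ℝ, ∀ t ∈ Set.Icc (0:ℝ) T, HasDerivAt (fun y => φ y t) (φx x t) x) ∧
  ContinuousOn (fun q : ℝ × ℝ => φ q.1 q.2) (Set.univ ×ˢ Set.Icc 0 T) ∧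
  ContinuousOn (fun q : ℝ × ℝ => φt q.1 q.2) (Set.univ ×ˢ Set.Icc 0 T) ∧
  ContinuousOn (fun q : ℝ × ℝ => φx q.1 q.2) (Set.univ ×ˢ Set.Icc 0 T) ∧
  (∃ R : ℝ, ∀ x : ℝ, ∀ t ∈ Set.Icc (0:ℝ) T, R ≤ |x| → φ x t = 0) ∧
  (∀ x : ℝ, φ x T = 0)

/-- The weak form of the equation, relative to a given precipitation function `p` and
the spatial derivative `w` of `u - ψ`. -/
def WeakForm (α β : ℝ) (u p w : ℝ → ℝ → ℝ) : Prop :=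
  ∀ T > (0:ℝ), ∀ φ φt φx : ℝ → ℝ → ℝ, IsTestFun T φ φt φx →
    (∫ t in Set.Ioc (0:ℝ) T, ∫ x : ℝ, φt x t * (u x t - psi α β x t))
      = ∫ t in Set.Ioc (0:ℝ) T, ∫ x : ℝ, (φx x t * w x t + p x t * u x t * φ x t)

/-- A weak solution of the linear auxiliary problem with given precipitation function `p`. -/
def IsAuxSolution (α β : ℝ) (p u : ℝ → ℝ → ℝ) : Prop :=
  (∀ x t : ℝ, u (-x) t = u x t) ∧
  ∃ w : ℝ → ℝ → ℝ, AuxReg α β u w ∧ WeakForm α β u p w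

/-- A weak solution `(u, p)` of the HHMO model. -/
def IsWeakSolution (α β ustar : ℝ) (u p : ℝ → ℝ → ℝ) : Prop :=
  (∀ x t : ℝ, u (-x) t = u x t) ∧
  (∀ x t : ℝ, p (-x) t = p x t) ∧
  Measurable (fun q : ℝ × ℝ => p q.1 q.2) ∧
  (∀ x : ℝ, ∀ t ∈ Set.Ici (0:ℝ),
    (sSup ((fun s => u x s) '' Set.Icc 0 t) < ustar → p x t = 0) ∧
    (sSup ((fun s => u x s) '' Set.Icc 0 t) = ustar → p x t ∈ Set.Icc (0:ℝ) 1) ∧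
    (ustar < sSup ((fun s => u x s) '' Set.Icc 0 t) → p x t = 1)) ∧
  (∀ x : ℝ, MonotoneOn (fun t => p x t) (Set.Ici (0:ℝ))) ∧
  ∃ w : ℝ → ℝ → ℝ, AuxReg α β u w ∧ WeakForm α β u p w

/-- Condition (P): the precipitation function depends only on `x` beyond the parabola
`t = x²/α²`. -/
def CondP (α : ℝ) (p : ℝ → ℝ → ℝ) (pstar : ℝ → ℝ) : Prop :=
  Measurable pstar ∧
  ∀ᵐ x ∂(volume.restrict (Set.Ioi (0:ℝ))), ∀ t : ℝ, x ^ 2 / α ^ 2 < t → p x t = pstar x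

/-- The admissible class `𝒜` of precipitation functions. -/
def IsAdmissible (p : ℝ → ℝ → ℝ) : Prop :=
  (∀ x t : ℝ, p (-x) t = p x t) ∧
  MeasureTheory.LocallyIntegrableOn (fun q : ℝ × ℝ => p q.1 q.2) (Set.Ioi 0 ×ˢ Set.Ici 0) ∧
  ∀ T > (0:ℝ), ∃ R : ℝ, ∀ x ≥ R, ∀ t ∈ Set.Icc (0:ℝ) T, p x t = 0

/-- `u` converges uniformly, in parabolic similarity coordinates, to the profile `Φ`. -/
def ConvUnif (u : ℝ → ℝ → ℝ) (Φ : ℝ → ℝ) : Prop :=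
  ∀ ε > (0:ℝ), ∃ T : ℝ, ∀ t ≥ T, ∀ η ≥ (0:ℝ), |u (η * Real.sqrt t) t - Φ η| < ε

/-- The error function. -/
def erf (x : ℝ) : ℝ := (2 / Real.sqrt Real.pi) * ∫ s in (0:ℝ)..x, Real.exp (-s ^ 2)

/-- The complementary error function. -/
def erfc (x : ℝ) : ℝ := (2 / Real.sqrt Real.pi) * ∫ s in Set.Ioi x, Real.exp (-s ^ 2)

/-- Kummer's confluent hypergeometric function `M(a,b,z)` (real arguments). -/
def kummerM (a b z : ℝ) : ℝ :=
  ∑' n : ℕ, (Polynomial.eval a (ascPochhammer ℝ n) / Polynomial.eval b (ascPochhammer ℝ n))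
    * z ^ n / (n.factorial : ℝ)

/-- `κ = (1 + √(4γ+1))/2`, the positive root of `κ(κ-1) = γ`. -/
def kappaOf (γ : ℝ) : ℝ := (1 + Real.sqrt (4 * γ + 1)) / 2

/-- The value `u*_γ` determined by the derivative matching condition. -/
def ustarGamma (α β γ : ℝ) : ℝ :=
  (α * β / 2) *
    (kappaOf γ * kummerM (kappaOf γ / 2 + 1) (kappaOf γ + 1 / 2) (-α ^ 2 / 4) /
        (α * kummerM (kappaOf γ / 2) (kappaOf γ + 1 / 2) (-α ^ 2 / 4)) +
      Real.exp (-α ^ 2 / 4) / (Real.sqrt Real.pi * erfc (α / 2)))⁻¹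

/-- The self-similar profile `Φ_γ`. -/
def Phi (α β γ η : ℝ) : ℝ :=
  if η < α then
    ustarGamma α β γ * η ^ kappaOf γ *
      kummerM (kappaOf γ / 2) (kappaOf γ + 1 / 2) (-η ^ 2 / 4) /
      (α ^ kappaOf γ * kummerM (kappaOf γ / 2) (kappaOf γ + 1 / 2) (-α ^ 2 / 4))
  else ustarGamma α β γ * erfc (η / 2) / erfc (α / 2)

/-- `h` is of class `C^{2,1}` near `z`, and `g` is `∂ₜh - ∂ₓₓh` there. -/
def HasHeatOpAt (h : ℝ → ℝ → ℝ) (g : ℝ × ℝ → ℝ) (z : ℝ × ℝ) : Prop :=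
  ContinuousAt g z ∧ ∃ hx hxx ht : ℝ × ℝ → ℝ, ∀ᶠ q in nhds z,
    ContinuousAt (fun q : ℝ × ℝ => h q.1 q.2) q ∧
    HasDerivAt (fun y => h y q.2) (hx q) q.1 ∧
    HasDerivAt (fun y => hx (y, q.2)) (hxx q) q.1 ∧
    HasDerivAt (fun s => h q.1 s) (ht q) q.2 ∧ ht q - hxx q = g q

lemma HasHeatOpAt.sub {h k : ℝ → ℝ → ℝ} {f g : ℝ × ℝ → ℝ} {z : ℝ × ℝ}
    (hf : HasHeatOpAt h f z) (hg : HasHeatOpAt k g z) :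
    HasHeatOpAt (fun x t => h x t - k x t) (fun q => f q - g q) z := by
  obtain ⟨hf0, hx, hxx, ht, H⟩ := hf
  obtain ⟨hg0, kx, kxx, kt, K⟩ := hg
  refine ⟨hf0.sub hg0, fun q => hx q - kx q, fun q => hxx q - kxx q, fun q => ht q - kt q, ?_⟩
  filter_upwards [H, K] with q h1 h2
  exact ⟨h1.1.sub h2.1, h1.2.1.sub h2.2.1, h1.2.2.1.sub h2.2.2.1, h1.2.2.2.1.sub h2.2.2.2.1,
    by linarith [h1.2.2.2.2, h2.2.2.2.2]⟩

lemma not_isLocalMax_of_hasDerivAt_pos {g g' : ℝ → ℝ} {x a : ℝ}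
    (h1 : ∀ᶠ y in nhds x, HasDerivAt g (g' y) y) (h2 : HasDerivAt g' a x) (ha : 0 < a) :
    ¬ IsLocalMax g x := by
  intro hmax
  have hd : deriv g =ᶠ[nhds x] g' := h1.mono fun y hy => hy.deriv
  have h0 : deriv g x = 0 := hmax.deriv_eq_zero
  have hdd : deriv (deriv g) x = a := by rw [hd.deriv_eq]; exact h2.deriv
  have hmin : IsLocalMin g x :=
    isLocalMin_of_deriv_deriv_pos (by rw [hdd]; exact ha) h0 h1.self_of_nhds.continuousAt
  have hc : g =ᶠ[nhds x] fun _ => g x := by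
    filter_upwards [hmax, hmin] with y hy1 hy2
    exact le_antisymm hy1 hy2
  have h3 : deriv g =ᶠ[nhds x] fun _ => 0 := by
    have := hc.deriv
    simpa using this
  have h4 : deriv (deriv g) x = 0 := by rw [h3.deriv_eq]; simp
  linarith

lemma nonneg_of_hasDerivAt_of_le_left {g : ℝ → ℝ} {t a : ℝ} (h : HasDerivAt g a t)
    (hmax : ∀ᶠ s in nhdsWithin t (Iio t), g s ≤ g t) : 0 ≤ a := by
  have h1 : Tendsto (slope g t) (nhdsWithin t (Iio t)) (nhds a) :=
    (hasDerivAt_iff_tendsto_slope.1 h).mono_left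
      (nhdsWithin_mono t fun s hs => ne_of_lt (mem_Iio.1 hs))
  refine ge_of_tendsto h1 ?_
  filter_upwards [hmax, self_mem_nhdsWithin] with s hs hst
  rw [slope_def_field]
  exact div_nonneg_of_nonpos (by linarith) (by linarith [show s < t from hst])

/-- Parabolic comparison: `F ≤ h` on a region `{lo t ≤ x ≤ hi t, s ≤ t ≤ T}` if this holds on the
parabolic boundary and `F - h` has no positive backward-in-time local maximum in the interior. -/
lemma parabolic_comparison {F h : ℝ → ℝ → ℝ} {lo hi : ℝ → ℝ} {s T : ℝ}
    (hlo : Continuous lo) (hhi : Continuous hi)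
    (hF : ContinuousOn (fun q : ℝ × ℝ => F q.1 q.2)
      {q : ℝ × ℝ | q.2 ∈ Icc s T ∧ lo q.2 ≤ q.1 ∧ q.1 ≤ hi q.2})
    (hh : ContinuousOn (fun q : ℝ × ℝ => h q.1 q.2)
      {q : ℝ × ℝ | q.2 ∈ Icc s T ∧ lo q.2 ≤ q.1 ∧ q.1 ≤ hi q.2})
    (hbot : ∀ x, lo s ≤ x → x ≤ hi s → F x s ≤ h x s)
    (hl : ∀ t ∈ Icc s T, F (lo t) t ≤ h (lo t) t)
    (hr : ∀ t ∈ Icc s T, F (hi t) t ≤ h (hi t) t)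
    (hinterior : ∀ t ∈ Ioc s T, ∀ x ∈ Ioo (lo t) (hi t), h x t < F x t →
      ¬ ∀ᶠ q in nhdsWithin (x, t) {q : ℝ × ℝ | q.2 ≤ t},
        F q.1 q.2 - h q.1 q.2 ≤ F x t - h x t) :
    ∀ t ∈ Icc s T, ∀ x, lo t ≤ x → x ≤ hi t → F x t ≤ h x t := by
  intro t ht x hx1 hx2
  set K := {q : ℝ × ℝ | q.2 ∈ Icc s T ∧ lo q.2 ≤ q.1 ∧ q.1 ≤ hi q.2} with hK
  have hcl : IsClosed K := by
    have e : K = (Prod.snd ⁻¹' Icc s T) ∩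
        ({q : ℝ × ℝ | lo q.2 ≤ q.1} ∩ {q : ℝ × ℝ | q.1 ≤ hi q.2}) := rfl
    rw [e]
    exact (isClosed_Icc.preimage continuous_snd).inter
      ((isClosed_le (hlo.comp continuous_snd) continuous_fst).inter
        (isClosed_le continuous_fst (hhi.comp continuous_snd)))
  have hcomp : IsCompact K := by
    obtain ⟨m, hm⟩ := (isCompact_Icc.image hlo : IsCompact (lo '' Icc s T)).bddBelow
    obtain ⟨M, hM⟩ := (isCompact_Icc.image hhi : IsCompact (hi '' Icc s T)).bddAbove
    refine (isCompact_Icc.prod isCompact_Icc :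
      IsCompact (Icc m M ×ˢ Icc s T)).of_isClosed_subset hcl ?_
    rintro q ⟨h1, h2, h3⟩
    exact ⟨⟨(hm ⟨_, h1, rfl⟩).trans h2, h3.trans (hM ⟨_, h1, rfl⟩)⟩, h1⟩
  obtain ⟨z, hz, hmax⟩ := hcomp.exists_isMaxOn ⟨(x, t), ht, hx1, hx2⟩ (hF.sub hh)
  by_contra! hcon
  have hpos : h z.1 z.2 < F z.1 z.2 := by
    have := hmax (show (x, t) ∈ K from ⟨ht, hx1, hx2⟩)
    have h2 : F x t - h x t ≤ F z.1 z.2 - h z.1 z.2 := this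
    linarith
  obtain ⟨hz1, hz2, hz3⟩ := hz
  have hs : s < z.2 := by
    rcases hz1.1.eq_or_lt with h' | h'
    · exact absurd (hbot z.1 (by rwa [h']) (by rwa [h'])) (by rw [h']; exact not_le.2 hpos)
    · exact h'
  have hlt : lo z.2 < z.1 := by
    rcases hz2.eq_or_lt with h' | h'
    · exact absurd (hl z.2 hz1) (by rw [h']; exact not_le.2 hpos)
    · exact h'
  have hgt : z.1 < hi z.2 := by
    rcases hz3.eq_or_lt with h' | h'
    · exact absurd (hr z.2 hz1) (by rw [← h']; exact not_le.2 hpos)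
    · exact h'
  refine hinterior z.2 ⟨hs, hz1.2⟩ z.1 ⟨hlt, hgt⟩ hpos ?_
  have e1 : ∀ᶠ q : ℝ × ℝ in nhds z, s < q.2 :=
    continuous_snd.continuousAt.eventually (lt_mem_nhds hs)
  have e2 : ∀ᶠ q : ℝ × ℝ in nhds z, lo q.2 < q.1 :=
    (hlo.comp continuous_snd).continuousAt.eventually_lt continuous_fst.continuousAt hlt
  have e3 : ∀ᶠ q : ℝ × ℝ in nhds z, q.1 < hi q.2 :=
    continuous_fst.continuousAt.eventually_lt (hhi.comp continuous_snd).continuousAt hgt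
  filter_upwards [mem_nhdsWithin_of_mem_nhds e1, mem_nhdsWithin_of_mem_nhds e2,
    mem_nhdsWithin_of_mem_nhds e3, self_mem_nhdsWithin] with q h1 h2 h3 h4
  exact hmax (show q ∈ K from
    ⟨⟨le_of_lt h1, le_trans h4 hz1.2⟩, le_of_lt h2, le_of_lt h3⟩)

/-- The Gaussian tail integral entering `psi`. -/
def gaussTail (y : ℝ) : ℝ := ∫ ζ in Set.Ioi y, Real.exp (-ζ ^ 2 / 4)

lemma integrable_gauss : Integrable (fun ζ : ℝ => Real.exp (-ζ ^ 2 / 4)) := by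
  have := integrable_exp_neg_mul_sq (b := 1 / 4) (by norm_num)
  refine this.congr (Eventually.of_forall fun x => ?_)
  simp only
  congr 1
  ring

lemma gaussTail_eq (y : ℝ) :
    gaussTail y = gaussTail 0 - ∫ ζ in (0 : ℝ)..y, Real.exp (-ζ ^ 2 / 4) := by
  have h1 := integral_add_compl (μ := volume) (measurableSet_Iic (a := y)) integrable_gauss
  have h2 := integral_add_compl (μ := volume) (measurableSet_Iic (a := (0 : ℝ))) integrable_gauss
  have h3 := intervalIntegral.integral_Iic_sub_Iic (a := 0) (b := y) (μ := volume)
    integrable_gauss.integrableOn integrable_gauss.integrableOn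
  rw [compl_Iic] at h1 h2
  unfold gaussTail
  linarith

lemma hasDerivAt_gaussTail (y : ℝ) : HasDerivAt gaussTail (-Real.exp (-y ^ 2 / 4)) y := by
  have hc : Continuous fun ζ : ℝ => Real.exp (-ζ ^ 2 / 4) := by fun_prop
  have := (intervalIntegral.integral_hasDerivAt_right (hc.intervalIntegrable 0 y)
    hc.aestronglyMeasurable.stronglyMeasurableAtFilter hc.continuousAt).const_sub (gaussTail 0)
  rw [show gaussTail = fun y => gaussTail 0 - ∫ ζ in (0 : ℝ)..y, Real.exp (-ζ ^ 2 / 4) from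
    funext gaussTail_eq]
  simpa using this

lemma continuous_gaussTail : Continuous gaussTail :=
  continuous_iff_continuousAt.2 fun y => (hasDerivAt_gaussTail y).continuousAt

lemma antitone_gaussTail : Antitone gaussTail :=
  antitone_of_hasDerivAt_nonpos hasDerivAt_gaussTail
    fun y => by simp only [Pi.zero_apply]; linarith [Real.exp_pos (-y ^ 2 / 4)]

lemma gaussTail_nonneg (y : ℝ) : 0 ≤ gaussTail y :=
  setIntegral_nonneg measurableSet_Ioi fun _ _ => (Real.exp_pos _).le

lemma gaussTail_le (y : ℝ) : gaussTail y ≤ Real.exp (1 - y) := by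
  have h1 : ∫ ζ in Set.Ioi y, Real.exp 1 * Real.exp (-ζ) = Real.exp (1 - y) := by
    rw [integral_const_mul, integral_exp_neg_Ioi, ← Real.exp_add, sub_eq_add_neg]
  rw [← h1]
  refine setIntegral_mono_on integrable_gauss.integrableOn
    ((integrableOn_exp_neg_Ioi y).const_mul _) measurableSet_Ioi fun ζ _ => ?_
  rw [← Real.exp_add]
  exact Real.exp_le_exp.2 (by nlinarith [sq_nonneg (ζ / 2 - 1)])

lemma psi_of_pos {α β x t : ℝ} (ht : 0 < t) :
    psi α β x t = (α * β / 2) * Real.exp (α ^ 2 / 4) * gaussTail (max (|x| / Real.sqrt t) α) := by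
  simp [psi, ht, gaussTail]

lemma psi_zero (α β x : ℝ) : psi α β x 0 = 0 := by simp [psi]

section
variable {α β : ℝ}

lemma psi_nonneg (hα : 0 < α) (hβ : 0 < β) (x t : ℝ) : 0 ≤ psi α β x t := by
  by_cases ht : 0 < t
  · rw [psi_of_pos ht]
    have := gaussTail_nonneg (max (|x| / Real.sqrt t) α)
    positivity
  · simp [psi, ht]

lemma psi_le (hα : 0 < α) (hβ : 0 < β) (x t : ℝ) :
    psi α β x t ≤ (α * β / 2) * Real.exp (α ^ 2 / 4) * gaussTail α := by
  have h0 := gaussTail_nonneg α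
  by_cases ht : 0 < t
  · rw [psi_of_pos ht]
    exact mul_le_mul_of_nonneg_left (antitone_gaussTail (le_max_right _ _)) (by positivity)
  · simp only [psi, ht, if_false]
    positivity

/-- `psi` is uniformly small where `|x| / √t` is large. -/
lemma exists_psi_le (hα : 0 < α) (hβ : 0 < β) {ε : ℝ} (hε : 0 < ε) :
    ∃ X : ℝ, 0 < X ∧ ∀ x t : ℝ, X * Real.sqrt t ≤ x → psi α β x t ≤ ε := by
  set c := (α * β / 2) * Real.exp (α ^ 2 / 4) with hc
  have hc0 : 0 < c := by positivity
  have h1 : Tendsto (fun y : ℝ => c * Real.exp (1 - y)) atTop (nhds 0) := by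
    have : Tendsto (fun y : ℝ => Real.exp (1 - y)) atTop (nhds 0) :=
      Real.tendsto_exp_atBot.comp (tendsto_atBot_add_const_left _ 1 tendsto_neg_atTop_atBot)
    simpa using this.const_mul c
  obtain ⟨X, hX, hX0⟩ := ((h1.eventually (ge_mem_nhds hε)).and (eventually_gt_atTop 0)).exists
  refine ⟨X, hX0, fun x t hxt => ?_⟩
  by_cases ht : 0 < t
  · rw [psi_of_pos ht]
    have hs := Real.sqrt_pos.2 ht
    refine le_trans (mul_le_mul_of_nonneg_left ((antitone_gaussTail ?_).trans (gaussTail_le X))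
      hc0.le) hX
    refine le_trans ?_ (le_max_left _ _)
    rw [le_div_iff₀ hs]
    exact hxt.trans (le_abs_self x)
  · simp [psi, ht, hε.le]

lemma continuousAt_psi {q : ℝ × ℝ} (hq : 0 < q.2) :
    ContinuousAt (fun q : ℝ × ℝ => psi α β q.1 q.2) q := by
  have h1 : ContinuousAt (fun q : ℝ × ℝ => (α * β / 2) * Real.exp (α ^ 2 / 4) *
      gaussTail (max (|q.1| / Real.sqrt q.2) α)) q := by
    refine ContinuousAt.mul continuousAt_const (continuous_gaussTail.continuousAt.comp ?_)
    have h2 : ContinuousAt (fun q : ℝ × ℝ => |q.1| / Real.sqrt q.2) q :=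
      ContinuousAt.div (by fun_prop) (by fun_prop) (Real.sqrt_pos.2 hq).ne'
    exact h2.sup continuousAt_const
  refine h1.congr ?_
  filter_upwards [continuous_snd.continuousAt.eventually (lt_mem_nhds hq)] with r hr
  exact (psi_of_pos hr).symm

lemma hasHeatOpAt_psi_of_lt {z : ℝ × ℝ} (hα : 0 < α) (hz : 0 < z.2)
    (h : α * Real.sqrt z.2 < z.1) : HasHeatOpAt (psi α β) (fun _ => 0) z := by
  set c := (α * β / 2) * Real.exp (α ^ 2 / 4) with hc
  set hx : ℝ × ℝ → ℝ := fun q =>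
    c * (-Real.exp (-(q.1 / Real.sqrt q.2) ^ 2 / 4) * (1 / Real.sqrt q.2)) with hhx
  set ht : ℝ × ℝ → ℝ := fun q =>
    c * (Real.exp (-(q.1 / Real.sqrt q.2) ^ 2 / 4) * (q.1 / (2 * (q.2 * Real.sqrt q.2)))) with hht
  refine ⟨continuousAt_const, hx, ht, ht, ?_⟩
  set U := {q : ℝ × ℝ | 0 < q.2 ∧ α * Real.sqrt q.2 < q.1} with hU
  have hUo : IsOpen U := (isOpen_lt continuous_const continuous_snd).inter
    (isOpen_lt (by fun_prop) continuous_fst)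
  have hpsi : ∀ q ∈ U, psi α β q.1 q.2 = c * gaussTail (q.1 / Real.sqrt q.2) := by
    rintro q ⟨h1, h2⟩
    have hs := Real.sqrt_pos.2 h1
    have hq : 0 < q.1 := lt_of_le_of_lt (by positivity) h2
    rw [psi_of_pos h1, abs_of_pos hq, max_eq_left]
    rw [le_div_iff₀ hs]
    exact h2.le
  filter_upwards [hUo.mem_nhds (show z ∈ U from ⟨hz, h⟩)] with q hq
  have hs := Real.sqrt_pos.2 hq.1
  have hsq := Real.mul_self_sqrt hq.1.le
  have n1 : ∀ᶠ y in nhds q.1, (y, q.2) ∈ U :=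
    (Continuous.prodMk continuous_id continuous_const).continuousAt.eventually (hUo.mem_nhds hq)
  have n2 : ∀ᶠ s in nhds q.2, (q.1, s) ∈ U :=
    (Continuous.prodMk continuous_const continuous_id).continuousAt.eventually (hUo.mem_nhds hq)
  refine ⟨continuousAt_psi hq.1, ?_, ?_, ?_, sub_self _⟩
  · have h1 := ((hasDerivAt_gaussTail (q.1 / Real.sqrt q.2)).comp q.1
      ((hasDerivAt_id q.1).div_const (Real.sqrt q.2))).const_mul c
    refine h1.congr_of_eventuallyEq ?_
    filter_upwards [n1] with y hy
    exact hpsi _ hy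
  · have h1 : HasDerivAt (fun y : ℝ => -(y / Real.sqrt q.2) ^ 2 / 4)
        (-(2 * (q.1 / Real.sqrt q.2) * (1 / Real.sqrt q.2)) / 4) q.1 := by
      have := ((((hasDerivAt_id q.1).div_const (Real.sqrt q.2)).pow 2).neg).div_const 4
      simpa using this
    have h2 := ((h1.exp.neg).mul_const (1 / Real.sqrt q.2)).const_mul c
    refine h2.congr_deriv ?_
    simp only [hht]
    rw [← hsq]
    field_simp
    ring_nf
    simp [Real.sqrt_sq hs.le]
  · have h1 : HasDerivAt (fun s : ℝ => q.1 / Real.sqrt s)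
        (-(q.1 / (2 * (q.2 * Real.sqrt q.2)))) q.2 := by
      have := (Real.hasDerivAt_sqrt hq.1.ne').inv hs.ne' |>.const_mul q.1
      refine (this.congr_deriv ?_).congr_of_eventuallyEq (Eventually.of_forall fun s => ?_)
      · rw [Real.sq_sqrt hq.1.le]
        field_simp
      · simp [div_eq_mul_inv]
    have h2 := ((hasDerivAt_gaussTail (q.1 / Real.sqrt q.2)).comp q.2 h1).const_mul c
    refine (h2.congr_of_eventuallyEq ?_).congr_deriv ?_
    · filter_upwards [n2] with s hs'
      exact hpsi _ hs'
    · simp only [hht]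
      ring

lemma hasHeatOpAt_psi_of_abs_lt {z : ℝ × ℝ} (hz : 0 < z.2)
    (h : |z.1| < α * Real.sqrt z.2) : HasHeatOpAt (psi α β) (fun _ => 0) z := by
  refine ⟨continuousAt_const, fun _ => 0, fun _ => 0, fun _ => 0, ?_⟩
  set U := {q : ℝ × ℝ | 0 < q.2 ∧ |q.1| < α * Real.sqrt q.2} with hU
  have hUo : IsOpen U := (isOpen_lt continuous_const continuous_snd).inter
    (isOpen_lt continuous_fst.abs (by fun_prop))
  have hpsi : ∀ q ∈ U, psi α β q.1 q.2 =
      (α * β / 2) * Real.exp (α ^ 2 / 4) * gaussTail α := by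
    rintro q ⟨h1, h2⟩
    rw [psi_of_pos h1, max_eq_right]
    rw [div_le_iff₀ (Real.sqrt_pos.2 h1)]
    exact h2.le
  filter_upwards [hUo.mem_nhds (show z ∈ U from ⟨hz, h⟩)] with q hq
  have n1 : ∀ᶠ y in nhds q.1, (y, q.2) ∈ U :=
    (Continuous.prodMk continuous_id continuous_const).continuousAt.eventually (hUo.mem_nhds hq)
  have n2 : ∀ᶠ s in nhds q.2, (q.1, s) ∈ U :=
    (Continuous.prodMk continuous_const continuous_id).continuousAt.eventually (hUo.mem_nhds hq)
  refine ⟨continuousAt_psi hq.1, ?_, hasDerivAt_const _ _, ?_, sub_self _⟩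
  · exact (hasDerivAt_const q.1 _).congr_of_eventuallyEq (n1.mono fun y hy => hpsi _ hy)
  · exact (hasDerivAt_const q.2 _).congr_of_eventuallyEq (n2.mono fun y hy => hpsi _ hy)

end

/-- `v` is a weak solution of `vₜ = vₓₓ - f` on `ℝ × [0,∞)` with zero initial data, continuous
together with its spatial derivative `w`. -/
structure WeakHeat (v w f : ℝ → ℝ → ℝ) : Prop where
  hasDerivAt : ∀ t ∈ Set.Ici (0:ℝ), ∀ x : ℝ, HasDerivAt (fun y => v y t) (w x t) x
  cont : ContinuousOn (fun q : ℝ × ℝ => v q.1 q.2) (Set.univ ×ˢ Set.Ici 0)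
  cont_deriv : ContinuousOn (fun q : ℝ × ℝ => w q.1 q.2) (Set.univ ×ˢ Set.Ici 0)
  bdd : ∀ T > (0:ℝ), ∃ C : ℝ, ∀ x : ℝ, ∀ t ∈ Set.Icc (0:ℝ) T,
    |v x t| ≤ C ∧ |w x t| ≤ C ∧ |f x t| ≤ C
  meas : ∀ T : ℝ, AEStronglyMeasurable (fun q : ℝ × ℝ => f q.1 q.2)
    (volume.restrict (univ ×ˢ Ioc 0 T))
  weak : ∀ T > (0:ℝ), ∀ φ φt φx : ℝ → ℝ → ℝ, IsTestFun T φ φt φx →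
    (∫ t in Set.Ioc (0:ℝ) T, ∫ x : ℝ, φt x t * v x t)
      = ∫ t in Set.Ioc (0:ℝ) T, ∫ x : ℝ, (φx x t * w x t + f x t * φ x t)

lemma integrableOn_strip_mul {G k : ℝ × ℝ → ℝ} {T C : ℝ}
    (hG : AEStronglyMeasurable G (volume.restrict (univ ×ˢ Ioc 0 T)))
    (hb : ∀ q : ℝ × ℝ, q.2 ∈ Ioc 0 T → |G q| ≤ C) (hk : Continuous k)
    (hk' : HasCompactSupport k) :
    IntegrableOn (fun q => G q * k q) (univ ×ˢ Ioc 0 T) := by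
  refine Integrable.bdd_mul (c := C) (hk.integrable_of_hasCompactSupport hk').integrableOn hG ?_
  exact (ae_restrict_mem (MeasurableSet.univ.prod measurableSet_Ioc)).mono fun q hq => hb q hq.2

lemma setIntegral_strip {g : ℝ × ℝ → ℝ} {T : ℝ} (hg : IntegrableOn g (univ ×ˢ Ioc 0 T)) :
    ∫ q in univ ×ˢ Ioc 0 T, g q = ∫ t in Ioc 0 T, ∫ x, g (x, t) := by
  have e : (volume : Measure (ℝ × ℝ)).restrict (univ ×ˢ Ioc 0 T) =
      (volume : Measure ℝ).prod ((volume : Measure ℝ).restrict (Ioc 0 T)) := by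
    rw [Measure.volume_eq_prod, ← Measure.prod_restrict, Measure.restrict_univ]
  unfold IntegrableOn at hg
  rw [e] at hg ⊢
  exact integral_prod_symm g hg

namespace WeakHeat

variable {v w f : ℝ → ℝ → ℝ}

lemma aestronglyMeasurable_of_continuousOn {g : ℝ × ℝ → ℝ} (T : ℝ)
    (hg : ContinuousOn g (univ ×ˢ Ici 0)) :
    AEStronglyMeasurable g (volume.restrict (univ ×ˢ Ioc 0 T)) :=
  (hg.mono (prod_mono_right fun _ ht => ht.1.le)).aestronglyMeasurable
    (MeasurableSet.univ.prod measurableSet_Ioc)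

set_option maxHeartbeats 800000 in
/-- Testing the weak equation against a translated smooth kernel. -/
lemma integral_kernel (H : WeakHeat v w f) {ρ : ℝ × ℝ → ℝ} (hρ : ContDiff ℝ 2 ρ)
    (hc : HasCompactSupport ρ) {z : ℝ × ℝ} {T : ℝ} (hT : 0 < T) (hz : ∀ x, ρ (z - (x, T)) = 0) :
    (∫ q in univ ×ˢ Ioc 0 T, v q.1 q.2 * fderiv ℝ ρ (z - q) (0, 1)) -
      (∫ q in univ ×ˢ Ioc 0 T,
        v q.1 q.2 * fderiv ℝ (fun a => fderiv ℝ ρ a (1, 0)) (z - q) (1, 0)) =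
      -∫ q in univ ×ˢ Ioc 0 T, f q.1 q.2 * ρ (z - q) := by
  obtain ⟨C, hC⟩ := H.bdd T hT
  have hd1 : ContDiff ℝ 1 (fun a => fderiv ℝ ρ a (1, 0)) :=
    (hρ.fderiv_right (by norm_num)).clm_apply contDiff_const
  have hct : Continuous (fun a => fderiv ℝ ρ a (0, 1)) :=
    ((hρ.fderiv_right (m := 1) (by norm_num)).clm_apply contDiff_const).continuous
  have hcxx : Continuous (fun a => fderiv ℝ (fun a => fderiv ℝ ρ a (1, 0)) a (1, 0)) :=
    ((hd1.fderiv_right (m := 0) (by norm_num)).clm_apply contDiff_const).continuous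
  have sx : HasCompactSupport (fun a => fderiv ℝ ρ a (1, 0)) := hc.fderiv_apply ℝ _
  have st : HasCompactSupport (fun a => fderiv ℝ ρ a (0, 1)) := hc.fderiv_apply ℝ _
  have sxx : HasCompactSupport (fun a => fderiv ℝ (fun a => fderiv ℝ ρ a (1, 0)) a (1, 0)) :=
    sx.fderiv_apply ℝ _
  have shift : ∀ {k : ℝ × ℝ → ℝ}, HasCompactSupport k → HasCompactSupport fun q => k (z - q) :=
    fun hk => hk.comp_homeomorph (Homeomorph.subLeft z)
  have cshift : ∀ {k : ℝ × ℝ → ℝ}, Continuous k → Continuous fun q => k (z - q) :=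
    fun hk => hk.comp (continuous_const.sub continuous_id)
  have mv := aestronglyMeasurable_of_continuousOn T H.cont
  have mw := aestronglyMeasurable_of_continuousOn T H.cont_deriv
  have bv : ∀ q : ℝ × ℝ, q.2 ∈ Ioc 0 T → |v q.1 q.2| ≤ C :=
    fun q hq => (hC q.1 q.2 ⟨hq.1.le, hq.2⟩).1
  have bw : ∀ q : ℝ × ℝ, q.2 ∈ Ioc 0 T → |w q.1 q.2| ≤ C :=
    fun q hq => (hC q.1 q.2 ⟨hq.1.le, hq.2⟩).2.1
  have bf : ∀ q : ℝ × ℝ, q.2 ∈ Ioc 0 T → |f q.1 q.2| ≤ C :=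
    fun q hq => (hC q.1 q.2 ⟨hq.1.le, hq.2⟩).2.2
  have ivt := integrableOn_strip_mul mv bv (cshift hct) (shift st)
  have ivxx := integrableOn_strip_mul mv bv (cshift hcxx) (shift sxx)
  have iwx := integrableOn_strip_mul mw bw (cshift hd1.continuous) (shift sx)
  have ifr := integrableOn_strip_mul (H.meas T) bf (cshift hρ.continuous) (shift hc)
  -- partial derivatives of the translated kernel
  have dx : ∀ {k : ℝ × ℝ → ℝ}, ContDiff ℝ 1 k → ∀ x t,
      HasDerivAt (fun y => k (z - (y, t))) (-fderiv ℝ k (z - (x, t)) (1, 0)) x := by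
    intro k hk x t
    have h1 : HasDerivAt (fun y : ℝ => z - (y, t)) (-((1 : ℝ), (0 : ℝ))) x :=
      ((hasDerivAt_id x).prodMk (hasDerivAt_const x t)).const_sub z
    have h2 := ((hk.differentiable (by norm_num)) (z - (x, t))).hasFDerivAt.comp_hasDerivAt x h1
    exact h2.congr_deriv (map_neg _ _)
  have dt : ∀ x t, HasDerivAt (fun s => ρ (z - (x, s))) (-fderiv ℝ ρ (z - (x, t)) (0, 1)) t := by
    intro x t
    have h1 : HasDerivAt (fun s : ℝ => z - (x, s)) (-((0 : ℝ), (1 : ℝ))) t :=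
      ((hasDerivAt_const t x).prodMk (hasDerivAt_id t)).const_sub z
    have h2 := ((hρ.differentiable (by norm_num)) (z - (x, t))).hasFDerivAt.comp_hasDerivAt t h1
    exact h2.congr_deriv (map_neg _ _)
  have htest : IsTestFun T (fun x t => ρ (z - (x, t))) (fun x t => -fderiv ℝ ρ (z - (x, t)) (0, 1))
      (fun x t => -fderiv ℝ ρ (z - (x, t)) (1, 0)) := by
    refine ⟨fun x t _ => (dt x t).hasDerivWithinAt,
      fun x t _ => dx (hρ.of_le (by norm_num)) x t,
      (cshift hρ.continuous).continuousOn, (cshift hct).neg.continuousOn,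
      (cshift hd1.continuous).neg.continuousOn, ?_, hz⟩
    obtain ⟨R, hR⟩ := (shift hc).isCompact.isBounded.subset_closedBall (0 : ℝ × ℝ)
    refine ⟨R + 1, fun x t _ hx => ?_⟩
    by_contra hne
    have h1 := hR (subset_tsupport _ (show ρ (z - (x, t)) ≠ 0 from hne))
    have h2 : |x| ≤ R := by
      have := (norm_fst_le ((x, t) : ℝ × ℝ)).trans (mem_closedBall_zero_iff.1 h1)
      simpa using this
    linarith
  have hw := H.weak T hT _ _ _ htest
  -- integration by parts in space
  have ibp : ∫ q in univ ×ˢ Ioc 0 T, w q.1 q.2 * fderiv ℝ ρ (z - q) (1, 0) =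
      ∫ q in univ ×ˢ Ioc 0 T,
        v q.1 q.2 * fderiv ℝ (fun a => fderiv ℝ ρ a (1, 0)) (z - q) (1, 0) := by
    rw [setIntegral_strip iwx, setIntegral_strip ivxx]
    refine setIntegral_congr_fun measurableSet_Ioc fun t ht => ?_
    have ct : Continuous fun y : ℝ => (y, t) := by fun_prop
    have cv : Continuous fun y => v y t := continuous_iff_continuousAt.2 fun x =>
      (H.hasDerivAt t ht.1.le x).continuousAt
    have cw : Continuous fun y => w y t := by
      rw [← continuousOn_univ]
      exact H.cont_deriv.comp ct.continuousOn fun y _ => ⟨mem_univ _, ht.1.le⟩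
    have sl : ∀ {k : ℝ × ℝ → ℝ}, HasCompactSupport k →
        HasCompactSupport fun y => k (z - (y, t)) := by
      intro k hk
      refine (shift hk).comp_isClosedEmbedding (g := fun y : ℝ => (y, t)) ?_
      exact (Isometry.of_dist_eq fun a b => by simp [Prod.dist_eq]).isClosedEmbedding
    have c1 := (cshift hd1.continuous).comp ct
    have c2 := (cshift hcxx).comp ct
    have key := integral_mul_deriv_eq_deriv_mul_of_integrable
      (u := fun y => v y t) (u' := fun y => w y t)
      (v := fun y => fderiv ℝ ρ (z - (y, t)) (1, 0))
      (v' := fun y => -fderiv ℝ (fun a => fderiv ℝ ρ a (1, 0)) (z - (y, t)) (1, 0))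
      (fun y _ => H.hasDerivAt t ht.1.le y) (fun y _ => dx hd1 y t)
      ((cv.mul c2.neg).integrable_of_hasCompactSupport (sl sxx).neg.mul_left)
      ((cw.mul c1).integrable_of_hasCompactSupport (sl sx).mul_left)
      ((cv.mul c1).integrable_of_hasCompactSupport (sl sx).mul_left)
    simp only [mul_neg, integral_neg, neg_inj] at key
    exact key.symm
  have e1 : (∫ t in Set.Ioc (0:ℝ) T, ∫ x : ℝ, -fderiv ℝ ρ (z - (x, t)) (0, 1) * v x t) =
      -∫ q in univ ×ˢ Ioc 0 T, v q.1 q.2 * fderiv ℝ ρ (z - q) (0, 1) := by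
    rw [setIntegral_strip ivt, ← integral_neg]
    refine integral_congr_ae (Eventually.of_forall fun t => ?_)
    simp only [← integral_neg]
    refine integral_congr_ae (Eventually.of_forall fun x => ?_)
    simp only
    ring
  have e2 : (∫ t in Set.Ioc (0:ℝ) T, ∫ x : ℝ,
        (-fderiv ℝ ρ (z - (x, t)) (1, 0) * w x t + f x t * ρ (z - (x, t)))) =
      -(∫ q in univ ×ˢ Ioc 0 T, w q.1 q.2 * fderiv ℝ ρ (z - q) (1, 0)) +
      ∫ q in univ ×ˢ Ioc 0 T, f q.1 q.2 * ρ (z - q) := by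
    rw [← integral_neg]
    refine Eq.trans ?_ (integral_add iwx.neg ifr)
    refine Eq.trans ?_ (setIntegral_strip (iwx.neg.add ifr)).symm
    refine integral_congr_ae (Eventually.of_forall fun t => ?_)
    refine integral_congr_ae (Eventually.of_forall fun x => ?_)
    simp
    ring
  rw [e1, e2, ibp] at hw
  linarith

open scoped Convolution in
/-- Local approximation of a weak solution by `C^{2,1}` functions satisfying the same
differential inequality. -/
lemma exists_smooth_approx (H : WeakHeat v w f) {z₀ : ℝ × ℝ} {r c δ : ℝ} (hr : 0 < r)
    (hrt : 2 * r < z₀.2) (hδ : 0 < δ)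
    (hf : ∀ q ∈ Metric.closedBall z₀ (2 * r), -f q.1 q.2 ≤ c) :
    ∃ V Vx Vxx Vt : ℝ × ℝ → ℝ, Continuous V ∧
      (∀ q, HasDerivAt (fun y => V (y, q.2)) (Vx q) q.1) ∧
      (∀ q, HasDerivAt (fun y => Vx (y, q.2)) (Vxx q) q.1) ∧
      (∀ q, HasDerivAt (fun s => V (q.1, s)) (Vt q) q.2) ∧
      ∀ q ∈ Metric.closedBall z₀ r, Vt q - Vxx q ≤ c ∧ |V q - v q.1 q.2| ≤ δ := by
  set T := z₀.2 + 2 * r with hTdef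
  have hT : 0 < T := by linarith
  obtain ⟨C, hC⟩ := H.bdd T hT
  set S : Set (ℝ × ℝ) := univ ×ˢ Ioc 0 T with hS
  have hSm : MeasurableSet S := MeasurableSet.univ.prod measurableSet_Ioc
  set v0 : ℝ × ℝ → ℝ := S.indicator fun q => v q.1 q.2 with hv0
  have hv0m : AEStronglyMeasurable v0 volume :=
    (aestronglyMeasurable_indicator_iff hSm).2 (aestronglyMeasurable_of_continuousOn T H.cont)
  have hC0 : 0 ≤ C := (abs_nonneg _).trans (hC 0 0 ⟨le_rfl, hT.le⟩).1
  have hv0b : ∀ q, ‖v0 q‖ ≤ C := by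
    intro q
    by_cases hq : q ∈ S
    · rw [hv0, indicator_of_mem hq]
      exact (hC q.1 q.2 ⟨hq.2.1.le, hq.2.2⟩).1
    · rw [hv0, indicator_of_notMem hq]
      simpa using hC0
  have hloc : LocallyIntegrable v0 volume :=
    (memLp_top_of_bound hv0m C (Eventually.of_forall hv0b)).locallyIntegrable (by simp)
  have hball : ∀ q ∈ Metric.closedBall z₀ (2 * r), q ∈ S := by
    intro q hq
    have h1 : |q.2 - z₀.2| ≤ 2 * r := (le_max_right _ _).trans (Metric.mem_closedBall.1 hq)
    have h2 := abs_le.1 h1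
    exact ⟨mem_univ _, by linarith [h2.1], by linarith [h2.2]⟩
  obtain ⟨ε, hε, hεr, hu⟩ : ∃ ε > 0, ε ≤ r ∧ ∀ q ∈ Metric.closedBall z₀ r,
      ∀ y ∈ Metric.ball q ε, dist (v0 y) (v0 q) ≤ δ := by
    have hcv : ContinuousOn (fun q : ℝ × ℝ => v q.1 q.2) (Metric.closedBall z₀ (2 * r)) :=
      H.cont.mono fun q hq => ⟨mem_univ _, (hball q hq).2.1.le⟩
    have huc := (isCompact_closedBall z₀ (2 * r)).uniformContinuousOn_of_continuous hcv
    obtain ⟨ε, hε, h⟩ := Metric.uniformContinuousOn_iff.1 huc δ hδ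
    refine ⟨min ε r, lt_min hε hr, min_le_right _ _, fun q hq y hy => ?_⟩
    have hq' : q ∈ Metric.closedBall z₀ (2 * r) :=
      Metric.closedBall_subset_closedBall (by linarith) hq
    have hyq : dist y q < min ε r := hy
    have hy' : y ∈ Metric.closedBall z₀ (2 * r) := by
      rw [Metric.mem_closedBall] at hq ⊢
      linarith [dist_triangle y q z₀, min_le_right ε r]
    rw [hv0, indicator_of_mem (hball q hq'), indicator_of_mem (hball y hy')]
    exact (h y hy' q hq' (hyq.trans_le (min_le_left _ _))).le
  let φ : ContDiffBump (0 : ℝ × ℝ) := ⟨ε / 2, ε, by positivity, by linarith⟩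
  set ρ : ℝ × ℝ → ℝ := φ.normed volume with hρdef
  have hρ : ContDiff ℝ 2 ρ := φ.contDiff_normed
  have hρc : HasCompactSupport ρ := φ.hasCompactSupport_normed
  have hsupp : ∀ q : ℝ × ℝ, ε ≤ ‖q‖ → ρ q = 0 := by
    intro q hq
    have : q ∉ Function.support ρ := by
      rw [hρdef, φ.support_normed_eq]
      simpa [Metric.mem_ball, φ] using hq
    simpa using this
  set L := (ContinuousLinearMap.lsmul ℝ ℝ : ℝ →L[ℝ] ℝ →L[ℝ] ℝ).flip with hL
  have hd1 : ContDiff ℝ 1 (fun a => fderiv ℝ ρ a (1, 0)) :=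
    (hρ.fderiv_right (by norm_num)).clm_apply contDiff_const
  have sx : HasCompactSupport (fun a => fderiv ℝ ρ a (1, 0)) := hρc.fderiv_apply ℝ _
  have D : ∀ {k : ℝ × ℝ → ℝ}, ContDiff ℝ 1 k → HasCompactSupport k → ∀ (q e : ℝ × ℝ) {l : ℝ → ℝ × ℝ}
      {τ : ℝ}, HasDerivAt l e τ → l τ = q → HasDerivAt (fun y => (v0 ⋆[L, volume] k) (l y))
        ((v0 ⋆[L, volume] fun a => fderiv ℝ k a e) q) τ := by
    intro k hk hkc q e l τ hl hlq
    have h1 := hkc.hasFDerivAt_convolution_right L hloc hk q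
    rw [← hlq] at h1
    have h2 := h1.comp_hasDerivAt τ hl
    rwa [convolution_precompR_apply L hloc (hkc.fderiv ℝ) (hk.continuous_fderiv (by norm_num)),
      hlq] at h2
  have hconv : ∀ (k : ℝ × ℝ → ℝ) q, (v0 ⋆[L, volume] k) q =
      ∫ a in S, v a.1 a.2 * k (q - a) := by
    intro k q
    rw [convolution_def, ← integral_indicator hSm]
    refine integral_congr_ae (Eventually.of_forall fun a => ?_)
    simp only [hL, ContinuousLinearMap.flip_apply, ContinuousLinearMap.lsmul_apply, smul_eq_mul]
    by_cases ha : a ∈ S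
    · rw [hv0, indicator_of_mem ha, indicator_of_mem ha, mul_comm]
    · rw [hv0, indicator_of_notMem ha, indicator_of_notMem ha, mul_zero]
  refine ⟨v0 ⋆[L, volume] ρ, v0 ⋆[L, volume] fun a => fderiv ℝ ρ a (1, 0),
    v0 ⋆[L, volume] fun a => fderiv ℝ (fun a => fderiv ℝ ρ a (1, 0)) a (1, 0),
    v0 ⋆[L, volume] fun a => fderiv ℝ ρ a (0, 1),
    hρc.continuous_convolution_right L hloc hρ.continuous,
    fun q => D (hρ.of_le (by norm_num)) hρc q (1, 0)
      ((hasDerivAt_id q.1).prodMk (hasDerivAt_const q.1 q.2)) rfl,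
    fun q => D hd1 sx q (1, 0) ((hasDerivAt_id q.1).prodMk (hasDerivAt_const q.1 q.2)) rfl,
    fun q => D (hρ.of_le (by norm_num)) hρc q (0, 1)
      ((hasDerivAt_const q.2 q.1).prodMk (hasDerivAt_id q.2)) rfl, fun q hq => ⟨?_, ?_⟩⟩
  · have hq2 : |q.2 - z₀.2| ≤ r := (le_max_right _ _).trans (Metric.mem_closedBall.1 hq)
    rw [hconv, hconv, H.integral_kernel hρ hρc hT, ← integral_neg]
    · have hconst : Integrable (fun a => c * ρ (q - a)) := by
        refine Integrable.const_mul ?_ c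
        exact (hρ.continuous.integrable_of_hasCompactSupport hρc).comp_sub_left q
      have hle : ∀ a ∈ S, -(f a.1 a.2 * ρ (q - a)) ≤ c * ρ (q - a) := by
        intro a _
        rcases le_or_gt ε ‖q - a‖ with h | h
        · rw [hsupp _ h]; simp
        · have ha : a ∈ Metric.closedBall z₀ (2 * r) := by
            rw [Metric.mem_closedBall] at hq ⊢
            rw [← dist_eq_norm, dist_comm] at h
            linarith [dist_triangle a q z₀]
          have := mul_le_mul_of_nonneg_right (hf a ha) (φ.nonneg_normed (μ := volume) (q - a))
          rw [hρdef]
          linarith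
      have hfi := integrableOn_strip_mul (H.meas T)
        (fun a ha => (hC a.1 a.2 ⟨ha.1.le, ha.2⟩).2.2)
        (hρ.continuous.comp (continuous_const.sub continuous_id : Continuous fun a => q - a))
        (hρc.comp_homeomorph (Homeomorph.subLeft q))
      refine (setIntegral_mono_on hfi.neg hconst.integrableOn hSm hle).trans ?_
      have hS' : ∫ a in S, c * ρ (q - a) = ∫ a, c * ρ (q - a) := by
        refine setIntegral_eq_integral_of_forall_compl_eq_zero fun a ha => ?_
        rw [hsupp, mul_zero]
        by_contra! h
        refine ha (hball a ?_)
        rw [Metric.mem_closedBall] at hq ⊢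
        rw [← dist_eq_norm, dist_comm] at h
        linarith [dist_triangle a q z₀]
      rw [hS', integral_const_mul, integral_sub_left_eq_self ρ volume q, hρdef,
        φ.integral_normed, mul_one]
    · intro x
      refine hsupp _ ?_
      refine le_trans ?_ (norm_snd_le _)
      simp only [Prod.snd_sub, Real.norm_eq_abs]
      rw [abs_sub_comm]
      refine le_trans ?_ (le_abs_self _)
      linarith [(abs_le.1 hq2).2]
  · have h1 := φ.dist_normed_convolution_le (μ := volume) hv0m (x₀ := q) (ε := δ) (hu q hq)
    rw [← convolution_flip] at h1
    have hq' : q ∈ S := hball q (Metric.closedBall_subset_closedBall (by linarith) hq)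
    have h2 : v0 q = v q.1 q.2 := by rw [hv0, indicator_of_mem hq']
    rw [← h2]
    exact h1


/-- A weak subsolution cannot be touched from above, backward in time, by a strict
supersolution. -/
lemma not_touch (H : WeakHeat v w f) {h : ℝ → ℝ → ℝ} {g : ℝ × ℝ → ℝ} {z : ℝ × ℝ} {c : ℝ}
    (hz : 0 < z.2) (hf : ∀ᶠ q in nhds z, -f q.1 q.2 ≤ c) (hh : HasHeatOpAt h g z)
    (hc : c < g z) :
    ¬ ∀ᶠ q in nhdsWithin z {q : ℝ × ℝ | q.2 ≤ z.2},
      v q.1 q.2 - h q.1 q.2 ≤ v z.1 z.2 - h z.1 z.2 := by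
  intro htouch
  obtain ⟨hg, hx, hxx, ht, hh⟩ := hh
  set κ := (g z - c) / 2 with hκ
  have hκ0 : 0 < κ := by linarith
  have hg' : ∀ᶠ q in nhds z, c + κ < g q := hg.eventually (lt_mem_nhds (by linarith))
  rw [eventually_nhdsWithin_iff] at htouch
  obtain ⟨R, hR, hall⟩ := Metric.eventually_nhds_iff.1 (hf.and (hh.and (hg'.and htouch)))
  obtain ⟨r, hr, hr1, hrR, hrz⟩ : ∃ r > 0, r ≤ 1 ∧ 2 * r < R ∧ 2 * r < z.2 := by
    refine ⟨min 1 (min R z.2 / 4), by positivity, min_le_left _ _, ?_, ?_⟩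
    · linarith [min_le_right 1 (min R z.2 / 4), min_le_left R z.2]
    · linarith [min_le_right 1 (min R z.2 / 4), min_le_right R z.2]
  have hnear : ∀ q ∈ Metric.closedBall z r, dist q z < R := fun q hq => by
    have := Metric.mem_closedBall.1 hq
    linarith
  set μ := κ / 8 with hμ
  have hμ0 : 0 < μ := by positivity
  obtain ⟨V, Vx, Vxx, Vt, hVc, hVx, hVxx, hVt, hV⟩ := H.exists_smooth_approx (c := c)
    (δ := μ * r ^ 2 / 4) hr hrz (by positivity)
    fun q hq => (hall ((Metric.mem_closedBall.1 hq).trans_lt hrR)).1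
  set K : Set (ℝ × ℝ) := Icc (z.1 - r) (z.1 + r) ×ˢ Icc (z.2 - r) z.2 with hK
  have hKb : ∀ q ∈ K, q ∈ Metric.closedBall z r := by
    rintro q ⟨⟨h1, h2⟩, h3, h4⟩
    rw [Metric.mem_closedBall, Prod.dist_eq]
    refine max_le ?_ ?_ <;> rw [Real.dist_eq, abs_le] <;> constructor <;> linarith
  have hzK : z ∈ K := ⟨⟨by linarith, by linarith⟩, by linarith, le_rfl⟩
  set G : ℝ × ℝ → ℝ := fun q => V q - h q.1 q.2 - μ * ((q.1 - z.1) ^ 2 + (q.2 - z.2) ^ 2) with hG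
  have hGc : ContinuousOn G K := by
    refine (hVc.continuousOn.sub fun q hq => ?_).sub (by fun_prop)
    exact (hall (hnear q (hKb q hq))).2.1.1.continuousWithinAt
  obtain ⟨m, hm, hmax⟩ := (isCompact_Icc.prod isCompact_Icc : IsCompact K).exists_isMaxOn
    ⟨z, hzK⟩ hGc
  obtain ⟨hma, ⟨_, hmx, hmxx, hmt, hmg⟩, hmκ, hmtouch⟩ := hall (hnear m (hKb m hm))
  obtain ⟨hmVc, hmV⟩ := hV m (hKb m hm)
  have hzV := (hV z (hKb z hzK)).2
  have hGzm : G z ≤ G m := hmax hzK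
  have hdist : (m.1 - z.1) ^ 2 + (m.2 - z.2) ^ 2 < r ^ 2 := by
    by_contra! hcon
    have h1 : v m.1 m.2 - h m.1 m.2 ≤ v z.1 z.2 - h z.1 z.2 := hmtouch hm.2.2
    have h2 := mul_le_mul_of_nonneg_left hcon hμ0.le
    have h3 : 0 < μ * r ^ 2 := by positivity
    simp only [hG, sub_self] at hGzm
    have h4 := abs_le.1 hmV
    have h5 := abs_le.1 hzV
    nlinarith [h4.2, h5.1]
  have hb1 : |m.1 - z.1| < r := abs_lt_of_sq_lt_sq (by nlinarith [sq_nonneg (m.2 - z.2)]) hr.le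
  have hb2 : |m.2 - z.2| < r := abs_lt_of_sq_lt_sq (by nlinarith [sq_nonneg (m.1 - z.1)]) hr.le
  rw [abs_lt] at hb1 hb2
  -- time derivative at the maximum
  have htime : 0 ≤ Vt m - ht m - μ * (2 * (m.2 - z.2)) := by
    refine nonneg_of_hasDerivAt_of_le_left (g := fun s => G (m.1, s)) (t := m.2) ?_ ?_
    · have h1 : HasDerivAt (fun s : ℝ => μ * ((m.1 - z.1) ^ 2 + (s - z.2) ^ 2))
          (μ * (2 * (m.2 - z.2))) m.2 := by
        have := ((((hasDerivAt_id m.2).sub_const z.2).pow 2).const_add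
          ((m.1 - z.1) ^ 2)).const_mul μ
        simpa using this
      exact ((hVt m).sub hmt).sub h1
    · have : ∀ᶠ s in nhds m.2, z.2 - r < s := lt_mem_nhds (by linarith)
      filter_upwards [mem_nhdsWithin_of_mem_nhds this, self_mem_nhdsWithin] with s h1 h2
      exact hmax (show (m.1, s) ∈ K from ⟨hm.1, le_of_lt h1, (le_of_lt h2).trans hm.2.2⟩)
  -- second space derivative at the maximum
  have hnx : ∀ᶠ y in nhds m.1, dist (y, m.2) z < R :=
    (Continuous.dist (by fun_prop) continuous_const : Continuous fun y : ℝ =>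
      dist (y, m.2) z).continuousAt.eventually (gt_mem_nhds (hnear m (hKb m hm)))
  refine not_isLocalMax_of_hasDerivAt_pos (g := fun y => G (y, m.2)) (x := m.1)
    (g' := fun y => Vx (y, m.2) - hx (y, m.2) - μ * (2 * (y - z.1)))
    (a := Vxx m - hxx m - μ * 2) ?_ ?_ ?_ ?_
  · filter_upwards [hnx] with y hy
    have h1 : HasDerivAt (fun y : ℝ => μ * ((y - z.1) ^ 2 + (m.2 - z.2) ^ 2))
        (μ * (2 * (y - z.1))) y := by
      have := ((((hasDerivAt_id y).sub_const z.1).pow 2).add_const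
        ((m.2 - z.2) ^ 2)).const_mul μ
      simpa using this
    exact ((hVx (y, m.2)).sub (hall hy).2.1.2.1).sub h1
  · have h1 : HasDerivAt (fun y : ℝ => μ * (2 * (y - z.1))) (μ * 2) m.1 := by
      have := (((hasDerivAt_id m.1).sub_const z.1).const_mul 2).const_mul μ
      simpa using this
    exact ((hVxx m).sub hmxx).sub h1
  · have h1 : μ * (2 * (m.2 - z.2)) ≥ μ * (2 * (-1)) :=
      mul_le_mul_of_nonneg_left (by linarith [hb2.1]) hμ0.le
    linarith
  · have h1 : ∀ᶠ y in nhds m.1, z.1 - r < y := lt_mem_nhds (by linarith)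
    have h2 : ∀ᶠ y in nhds m.1, y < z.1 + r := gt_mem_nhds (by linarith)
    filter_upwards [h1, h2] with y h1 h2
    exact hmax (show (y, m.2) ∈ K from ⟨⟨h1.le, h2.le⟩, hm.2⟩)

lemma initial_nonpos (H : WeakHeat v w f) (x : ℝ) : v x 0 ≤ 0 := by
  by_contra! hk
  set k := v x 0 with hkdef
  obtain ⟨C, hC⟩ := H.bdd 1 one_pos
  have hC0 : 0 ≤ C := (abs_nonneg _).trans (hC 0 0 ⟨le_rfl, zero_le_one⟩).1
  have hev : ∀ᶠ q in nhdsWithin (x, 0) (Set.univ ×ˢ Set.Ici (0 : ℝ)), k / 2 < v q.1 q.2 :=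
    (H.cont (x, 0) ⟨mem_univ _, mem_Ici.2 (le_refl (0:ℝ))⟩).eventually
      (lt_mem_nhds (by simp only; linarith))
  rw [eventually_nhdsWithin_iff] at hev
  obtain ⟨ε, hε, hev⟩ := Metric.eventually_nhds_iff.1 hev
  let φ : ContDiffBump x := ⟨ε / 2, ε, by positivity, by linarith⟩
  set a : ℝ → ℝ := φ.normed volume with ha
  have had : ContDiff ℝ 1 a := φ.contDiff_normed
  have hac : HasCompactSupport a := φ.hasCompactSupport_normed
  have ha0 : ∀ y, 0 ≤ a y := φ.nonneg_normed
  have ha1 : ∫ y, a y = 1 := φ.integral_normed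
  have hai : Integrable a := had.continuous.integrable_of_hasCompactSupport hac
  have hda : Continuous (deriv a) := had.continuous_deriv le_rfl
  have hdi : Integrable (deriv a) := hda.integrable_of_hasCompactSupport hac.deriv
  have hsupp : ∀ y, ε ≤ dist y x → a y = 0 := by
    intro y hy
    have : y ∉ Function.support a := by
      rw [ha, φ.support_normed_eq, Metric.mem_ball]
      exact not_lt.2 hy
    simpa using this
  set A := ∫ y, (|deriv a y| * C + C * a y) with hA
  have hAi : Integrable fun y => |deriv a y| * C + C * a y :=
    (hdi.abs.mul_const C).add (hai.const_mul C)
  have hA0 : 0 ≤ A := integral_nonneg fun y => by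
    have := ha0 y
    positivity
  obtain ⟨T, hT, hT1, hTε, hTA⟩ : ∃ T > 0, T ≤ 1 ∧ T < ε ∧ A * T < k / 2 := by
    refine ⟨min 1 (min (ε / 2) (k / (4 * (A + 1)))), by positivity, min_le_left _ _, ?_, ?_⟩
    · linarith [min_le_right 1 (min (ε / 2) (k / (4 * (A + 1)))),
        min_le_left (ε / 2) (k / (4 * (A + 1)))]
    · have h1 : min 1 (min (ε / 2) (k / (4 * (A + 1)))) ≤ k / (4 * (A + 1)) :=
        (min_le_right _ _).trans (min_le_right _ _)
      have h2 := mul_le_mul_of_nonneg_left h1 hA0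
      have h3 : A * (k / (4 * (A + 1))) ≤ k / 4 := by
        rw [mul_div_assoc', div_le_div_iff₀ (by positivity) (by norm_num)]
        nlinarith
      linarith
  have hTC : ∀ y : ℝ, ∀ s ∈ Icc 0 T, |v y s| ≤ C ∧ |w y s| ≤ C ∧ |f y s| ≤ C :=
    fun y s hs => hC y s ⟨hs.1, hs.2.trans hT1⟩
  have htest : IsTestFun T (fun y s => a y * (1 - s / T)) (fun y _ => a y * (-(1 / T)))
      (fun y s => deriv a y * (1 - s / T)) := by
    have c1 := had.continuous
    refine ⟨fun y s _ => ?_, fun y s _ => ?_, ?_, ?_, ?_, ?_, fun y => ?_⟩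
    · exact ((((hasDerivAt_id s).div_const T).const_sub 1).const_mul (a y)).hasDerivWithinAt
    · exact ((had.differentiable one_ne_zero y).hasDerivAt).mul_const _
    · exact Continuous.continuousOn (by fun_prop)
    · exact Continuous.continuousOn (by fun_prop)
    · exact Continuous.continuousOn (by fun_prop)
    · refine ⟨|x| + ε, fun y s _ hy => ?_⟩
      simp only
      rw [hsupp y, zero_mul]
      rw [Real.dist_eq]
      linarith [abs_sub_abs_le_abs_sub y x]
    · simp [hT.ne']
  have hw := H.weak T hT _ _ _ htest
  have hslice : ∀ s ∈ Icc 0 T, Continuous fun y => v y s := fun s hs =>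
    continuous_iff_continuousAt.2 fun y => (H.hasDerivAt s hs.1 y).continuousAt
  have hinner : ∀ s ∈ Ioc 0 T, ∫ y, a y * (-(1 / T)) * v y s ≤ -(k / 2 / T) := by
    intro s hs
    have hs' : s ∈ Icc 0 T := ⟨hs.1.le, hs.2⟩
    have e : -(k / 2 / T) = ∫ y, a y * (-(k / 2 / T)) := by
      rw [integral_mul_const, ha1, one_mul]
    rw [e]
    have ci := had.continuous
    have cs := hslice s hs'
    refine integral_mono ?_ (hai.mul_const _) fun y => ?_
    · exact (show Continuous fun y => a y * (-(1 / T)) * v y s by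
        fun_prop).integrable_of_hasCompactSupport (hac.mul_right.mul_right)
    · rcases le_or_gt ε (dist y x) with h | h
      · simp [hsupp y h]
      · have h1 : k / 2 < v y s := by
          refine hev (y := (y, s)) ?_ ⟨mem_univ _, hs.1.le⟩
          rw [Prod.dist_eq]
          refine max_lt h ?_
          rw [Real.dist_eq, sub_zero, abs_of_pos hs.1]
          exact hs.2.trans_lt hTε
        have h2 : k / 2 / T ≤ 1 / T * v y s := by
          rw [div_mul_eq_mul_div, one_mul]
          exact div_le_div_of_nonneg_right h1.le hT.le
        have := mul_le_mul_of_nonneg_left (neg_le_neg h2) (ha0 y)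
        simp only
        linarith
  have hJ : ContinuousOn (fun s => ∫ y, a y * (-(1 / T)) * v y s) (Icc 0 T) := by
    refine continuousOn_of_dominated (bound := fun y => a y * (1 / T) * C) ?_ ?_ ?_ ?_
    · intro s hs
      have ci := had.continuous
      have cs := hslice s hs
      exact (show Continuous fun y => a y * (-(1 / T)) * v y s by fun_prop).aestronglyMeasurable
    · intro s hs
      refine Eventually.of_forall fun y => ?_
      rw [norm_mul, norm_mul, norm_neg, Real.norm_of_nonneg (ha0 y),
        Real.norm_of_nonneg (by positivity : 0 ≤ 1 / T)]
      exact mul_le_mul_of_nonneg_left (hTC y s hs).1 (mul_nonneg (ha0 y) (by positivity))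
    · exact (hai.mul_const _).mul_const _
    · refine Eventually.of_forall fun y => ContinuousOn.mul continuousOn_const ?_
      exact H.cont.comp (Continuous.continuousOn (by fun_prop : Continuous fun s : ℝ => (y, s)))
        fun s hs => ⟨mem_univ _, hs.1⟩
  have hleft : (∫ s in Ioc (0 : ℝ) T, ∫ y, a y * (-(1 / T)) * v y s) ≤ -(k / 2) := by
    have h1 := setIntegral_mono_on (hJ.integrableOn_Icc.mono_set Ioc_subset_Icc_self)
      (integrableOn_const (C := -(k / 2 / T)) (μ := volume) (by simp)) measurableSet_Ioc hinner
    refine h1.trans_eq ?_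
    rw [setIntegral_const]
    simp [hT.le]
    field_simp
  have hright := norm_setIntegral_le_of_norm_le_const (μ := volume) (s := Ioc 0 T) (C := A)
    (f := fun s => ∫ y, (deriv a y * (1 - s / T) * w y s + f y s * (a y * (1 - s / T))))
    (by simp) (fun s hs => ?_)
  · rw [← hw, Real.norm_eq_abs] at hright
    have h2 := (abs_le.1 hright).1
    rw [Real.volume_real_Ioc_of_le hT.le, sub_zero] at h2
    linarith
  · refine norm_integral_le_of_norm_le hAi (Eventually.of_forall fun y => ?_)
    obtain ⟨_, h2, h3⟩ := hTC y s ⟨hs.1.le, hs.2⟩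
    have h4 : 0 ≤ 1 - s / T := by
      rw [sub_nonneg, div_le_one hT]; exact hs.2
    have h5 : 1 - s / T ≤ 1 := by linarith [div_pos hs.1 hT]
    have h6 : |1 - s / T| ≤ 1 := abs_le.2 ⟨by linarith, h5⟩
    refine (norm_add_le _ _).trans (add_le_add ?_ ?_)
    · rw [norm_mul, norm_mul]
      simp only [Real.norm_eq_abs]
      calc |deriv a y| * |1 - s / T| * |w y s| ≤ |deriv a y| * 1 * C := by gcongr
        _ = _ := by ring
    · rw [norm_mul, norm_mul]
      simp only [Real.norm_eq_abs]
      rw [abs_of_nonneg (ha0 y)]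
      calc |f y s| * (a y * |1 - s / T|) ≤ C * (a y * 1) := by
            have := ha0 y
            gcongr
        _ = _ := by ring

end WeakHeat

lemma hasHeatOpAt_quadratic (δ : ℝ) (z : ℝ × ℝ) :
    HasHeatOpAt (fun x t => δ * (x ^ 2 + 3 * t + 1)) (fun _ => δ) z := by
  refine ⟨continuousAt_const, fun q => δ * (2 * q.1), fun _ => δ * 2, fun _ => δ * 3,
    Eventually.of_forall fun q => ⟨?_, ?_, ?_, ?_, by ring⟩⟩
  · exact Continuous.continuousAt (by fun_prop)
  · have := ((((hasDerivAt_id q.1).pow 2).add_const (3 * q.2)).add_const 1).const_mul δ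
    simpa using this
  · simpa using ((hasDerivAt_id q.1).const_mul 2).const_mul δ
  · have := ((((hasDerivAt_id q.2).const_mul 3).const_add (q.1 ^ 2)).add_const 1).const_mul δ
    simpa using this

lemma hasHeatOpAt_affine (a k T : ℝ) (z : ℝ × ℝ) :
    HasHeatOpAt (fun _ t => a + k * (T - t)) (fun _ => -k) z := by
  refine ⟨continuousAt_const, fun _ => 0, fun _ => 0, fun _ => -k,
    Eventually.of_forall fun q => ⟨?_, hasDerivAt_const _ _, hasDerivAt_const _ _, ?_, by ring⟩⟩
  · exact Continuous.continuousAt (by fun_prop)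
  · have := (((hasDerivAt_id q.2).const_sub T).const_mul k).const_add a
    simpa using this

lemma hasHeatOpAt_cos (a ε lam k s x₀ : ℝ) (z : ℝ × ℝ) :
    HasHeatOpAt (fun x t => a - ε * Real.exp (-(lam * (t - s))) * Real.cos (k * (x - x₀)))
      (fun q => ε * Real.exp (-(lam * (q.2 - s))) * Real.cos (k * (q.1 - x₀)) * (lam - k ^ 2))
      z := by
  refine ⟨Continuous.continuousAt (by fun_prop),
    fun q => ε * Real.exp (-(lam * (q.2 - s))) * (Real.sin (k * (q.1 - x₀)) * k),
    fun q => ε * Real.exp (-(lam * (q.2 - s))) * (Real.cos (k * (q.1 - x₀)) * k * k),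
    fun q => ε * Real.exp (-(lam * (q.2 - s))) * lam * Real.cos (k * (q.1 - x₀)),
    Eventually.of_forall fun q => ⟨?_, ?_, ?_, ?_, by ring⟩⟩
  · exact Continuous.continuousAt (by fun_prop)
  · have h1 : HasDerivAt (fun x => k * (x - x₀)) k q.1 := by
      simpa using ((hasDerivAt_id q.1).sub_const x₀).const_mul k
    have := (h1.cos.const_mul (ε * Real.exp (-(lam * (q.2 - s))))).const_sub a
    exact this.congr_deriv (by ring)
  · have h1 : HasDerivAt (fun x => k * (x - x₀)) k q.1 := by
      simpa using ((hasDerivAt_id q.1).sub_const x₀).const_mul k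
    exact (h1.sin.mul_const k).const_mul (ε * Real.exp (-(lam * (q.2 - s))))
  · have h1 : HasDerivAt (fun t => -(lam * (t - s))) (-lam) q.2 := by
      simpa using (((hasDerivAt_id q.2).sub_const s).const_mul lam).fun_neg
    have := ((h1.exp.const_mul ε).mul_const (Real.cos (k * (q.1 - x₀)))).const_sub a
    exact this.congr_deriv (by ring)

namespace IsWeakSolution

variable {α β ustar : ℝ} {u p : ℝ → ℝ → ℝ}

lemma mem_Icc (H : IsWeakSolution α β ustar u p) (x : ℝ) {t : ℝ} (ht : 0 ≤ t) :
    p x t ∈ Icc (0 : ℝ) 1 := by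
  obtain ⟨-, -, -, h, -⟩ := H
  obtain ⟨h1, h2, h3⟩ := h x t ht
  rcases lt_trichotomy (sSup ((fun s => u x s) '' Set.Icc 0 t)) ustar with h | h | h
  · rw [h1 h]; simp
  · exact h2 h
  · rw [h3 h]; simp

lemma abs_le_bound (hα : 0 < α) (hβ : 0 < β) {C x t : ℝ} (h : |u x t - psi α β x t| ≤ C) :
    |u x t| ≤ C + (α * β / 2) * Real.exp (α ^ 2 / 4) * gaussTail α := by
  have h1 := psi_nonneg hα hβ x t
  have h2 := psi_le hα hβ x t
  have h3 := abs_le.1 h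
  exact abs_le.2 ⟨by linarith, by linarith⟩

lemma continuousAt (H : IsWeakSolution α β ustar u p) {q : ℝ × ℝ} (hq : 0 < q.2) :
    ContinuousAt (fun q : ℝ × ℝ => u q.1 q.2) q := by
  obtain ⟨-, -, -, -, -, w, ⟨-, hc, -⟩, -⟩ := H
  have h1 : ContinuousAt (fun q : ℝ × ℝ => u q.1 q.2 - psi α β q.1 q.2) q := by
    refine hc.continuousAt ?_
    filter_upwards [(isOpen_lt continuous_const continuous_snd).mem_nhds hq] with r hr
    exact ⟨mem_univ _, le_of_lt hr⟩
  have := h1.fun_add (continuousAt_psi (α := α) (β := β) hq)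
  simpa only [sub_add_cancel] using this

lemma exists_weakHeat (H : IsWeakSolution α β ustar u p) (hα : 0 < α) (hβ : 0 < β) :
    ∃ w, WeakHeat (fun x t => u x t - psi α β x t) w (fun x t => p x t * u x t) := by
  obtain ⟨-, -, hpm, -, -, w, ⟨h1, h2, h3, h4⟩, h5⟩ := id H
  refine ⟨w, h1, h2, h3, fun T hT => ?_, fun T => ?_, h5⟩
  · obtain ⟨C, hC⟩ := h4 T hT
    have hM : 0 ≤ (α * β / 2) * Real.exp (α ^ 2 / 4) * gaussTail α :=
      (psi_nonneg hα hβ 0 0).trans (psi_le hα hβ 0 0)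
    refine ⟨C + (α * β / 2) * Real.exp (α ^ 2 / 4) * gaussTail α, fun x t ht => ?_⟩
    obtain ⟨h6, h7⟩ := hC x t ht
    have h8 := abs_le_bound hα hβ h6
    refine ⟨by linarith, by linarith, ?_⟩
    have h9 := H.mem_Icc x ht.1
    rw [abs_mul, abs_of_nonneg h9.1]
    exact (mul_le_of_le_one_left (abs_nonneg _) h9.2).trans h8
  · refine hpm.aestronglyMeasurable.mul ?_
    refine ContinuousOn.aestronglyMeasurable (fun q hq => ?_)
      (MeasurableSet.univ.prod measurableSet_Ioc)
    exact (H.continuousAt hq.2.1).continuousWithinAt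

lemma eq_one_of_lt (H : IsWeakSolution α β ustar u p) (hα : 0 < α) (hβ : 0 < β) {x t : ℝ}
    (ht : 0 ≤ t) (h : ustar < u x t) : p x t = 1 := by
  obtain ⟨-, -, -, hp, -, w, ⟨-, -, -, hb⟩, -⟩ := H
  refine (hp x t ht).2.2 (h.trans_le (le_csSup ?_ ⟨t, ⟨ht, le_rfl⟩, rfl⟩))
  obtain ⟨C, hC⟩ := hb (t + 1) (by linarith)
  refine ⟨C + (α * β / 2) * Real.exp (α ^ 2 / 4) * gaussTail α, ?_⟩
  rintro _ ⟨s, hs, rfl⟩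
  exact (le_abs_self _).trans
    (abs_le_bound hα hβ (hC x s ⟨hs.1, by linarith [hs.2]⟩).1)

lemma eventually_nonneg_absorption (H : IsWeakSolution α β ustar u p) {z : ℝ × ℝ}
    (hz : 0 < z.2) (h : 0 < u z.1 z.2) : ∀ᶠ q in nhds z, -(p q.1 q.2 * u q.1 q.2) ≤ 0 := by
  filter_upwards [(isOpen_lt continuous_const continuous_snd).mem_nhds hz,
    (H.continuousAt hz).eventually (lt_mem_nhds h)] with q h1 h2
  exact neg_nonpos.2 (mul_nonneg (H.mem_Icc _ (le_of_lt h1)).1 h2.le)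

lemma le_psi (H : IsWeakSolution α β ustar u p) (hα : 0 < α) (hβ : 0 < β) (x : ℝ) {t : ℝ}
    (ht : 0 ≤ t) : u x t ≤ psi α β x t := by
  obtain ⟨w, hw⟩ := H.exists_weakHeat hα hβ
  suffices key : ∀ δ > 0, u x t - psi α β x t ≤ δ * (x ^ 2 + 3 * t + 1) by
    by_contra! hlt
    have h1 : 0 < x ^ 2 + 3 * t + 1 := by positivity
    have := key ((u x t - psi α β x t) / (2 * (x ^ 2 + 3 * t + 1)))
      (div_pos (by linarith) (by positivity))
    rw [div_mul_eq_mul_div, le_div_iff₀ (by positivity)] at this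
    nlinarith
  intro δ hδ
  obtain ⟨C, hC⟩ := hw.bdd (t + 1) (by linarith)
  have hC0 : 0 ≤ C := (abs_nonneg _).trans (hC 0 0 ⟨le_rfl, by linarith⟩).1
  set R := |x| + C / δ + 1 with hR
  have hR1 : 1 ≤ R := by
    have : 0 ≤ C / δ := by positivity
    linarith [abs_nonneg x]
  have hRC : C ≤ δ * R ^ 2 := by
    have h1 : C / δ ≤ R := by linarith [abs_nonneg x]
    have h2 : C / δ ≤ R ^ 2 := by nlinarith
    rwa [div_le_iff₀' hδ] at h2
  have hside : ∀ y, y ^ 2 = R ^ 2 → ∀ r ∈ Icc 0 t,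
      u y r - psi α β y r ≤ δ * (y ^ 2 + 3 * r + 1) := by
    intro y hy r hr
    have h1 := (le_abs_self _).trans (hC y r ⟨hr.1, by linarith [hr.2]⟩).1
    have : 0 ≤ δ * (3 * r + 1) := mul_nonneg hδ.le (by linarith [hr.1])
    rw [hy]
    linarith
  refine parabolic_comparison (F := fun x t => u x t - psi α β x t)
    (h := fun x t => δ * (x ^ 2 + 3 * t + 1)) (lo := fun _ => -R) (hi := fun _ => R) (s := 0)
    (T := t) continuous_const continuous_const ?_ (Continuous.continuousOn (by fun_prop)) ?_
    (hside _ (by ring)) (hside _ rfl) ?_ t ⟨ht, le_rfl⟩ x ?_ ?_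
  · exact hw.cont.mono fun q hq => ⟨mem_univ _, hq.1.1⟩
  · intro y _ _
    exact (hw.initial_nonpos y).trans (by positivity)
  · intro r hr y _ hlt
    have hr0 : 0 < r := hr.1
    refine hw.not_touch (z := (y, r)) hr0 (c := 0)
      (H.eventually_nonneg_absorption hr0 ?_) (hasHeatOpAt_quadratic δ _) hδ
    have h1 : 0 < δ * (y ^ 2 + 3 * r + 1) := by positivity
    have h2 := psi_nonneg hα hβ y r
    simp only at hlt ⊢
    linarith
  · have : 0 ≤ C / δ := by positivity
    linarith [neg_abs_le x]
  · have : 0 ≤ C / δ := by positivity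
    linarith [le_abs_self x]

lemma not_touch (H : IsWeakSolution α β ustar u p) (hα : 0 < α) (hβ : 0 < β)
    {h : ℝ → ℝ → ℝ} {g : ℝ × ℝ → ℝ} {z : ℝ × ℝ} {c : ℝ} (hz : 0 < z.2)
    (hz' : α * Real.sqrt z.2 < z.1 ∨ |z.1| < α * Real.sqrt z.2)
    (hf : ∀ᶠ q in nhds z, -(p q.1 q.2 * u q.1 q.2) ≤ c) (hh : HasHeatOpAt h g z)
    (hc : c < g z) :
    ¬ ∀ᶠ q in nhdsWithin z {q : ℝ × ℝ | q.2 ≤ z.2},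
      u q.1 q.2 - h q.1 q.2 ≤ u z.1 z.2 - h z.1 z.2 := by
  obtain ⟨w, hw⟩ := H.exists_weakHeat hα hβ
  have hψ : HasHeatOpAt (psi α β) (fun _ => 0) z :=
    hz'.elim (hasHeatOpAt_psi_of_lt hα hz) (hasHeatOpAt_psi_of_abs_lt hz)
  have := hw.not_touch hz hf (hh.sub hψ) (by simpa using hc)
  simpa only [sub_sub_sub_cancel_right] using this

/-- A region free of the singular parabola and bounded laterally by curves on which `u ≤ u*`
has `u ≤ u*` throughout after a finite time. -/
lemma le_of_le_boundary (H : IsWeakSolution α β ustar u p) (hα : 0 < α) (hβ : 0 < β)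
    (hu : 0 < ustar) {lo hi : ℝ → ℝ} {s T : ℝ} (hs : 0 < s)
    (hT : s + (α * β / 2) * Real.exp (α ^ 2 / 4) * gaussTail α / ustar < T)
    (hlo : Continuous lo) (hhi : Continuous hi)
    (hl : ∀ t ∈ Icc s T, u (lo t) t ≤ ustar) (hr : ∀ t ∈ Icc s T, u (hi t) t ≤ ustar)
    (hreg : ∀ t ∈ Ioc s T, ∀ x ∈ Ioo (lo t) (hi t),
      α * Real.sqrt t < x ∨ |x| < α * Real.sqrt t) {x : ℝ} (hx : lo T ≤ x) (hx' : x ≤ hi T) :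
    u x T ≤ ustar := by
  set M := (α * β / 2) * Real.exp (α ^ 2 / 4) * gaussTail α with hM
  have hM0 : 0 ≤ M := (psi_nonneg hα hβ 0 0).trans (psi_le hα hβ 0 0)
  have hTs : 0 < T - s := by
    have : 0 ≤ M / ustar := by positivity
    linarith
  set k := M / (T - s) with hk
  have hk0 : 0 ≤ k := by positivity
  have hku : k < ustar := by
    rw [hk, div_lt_iff₀ hTs, mul_comm, ← div_lt_iff₀ hu]
    linarith
  have hkM : k * (T - s) = M := div_mul_cancel₀ _ hTs.ne'
  have hge : ∀ t ≤ T, ustar ≤ ustar + k * (T - t) := fun t ht => by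
    have := mul_nonneg hk0 (sub_nonneg.2 ht)
    linarith
  have := parabolic_comparison (F := u) (h := fun _ t => ustar + k * (T - t)) (s := s) (T := T)
    hlo hhi (fun q hq => (H.continuousAt (hs.trans_le hq.1.1)).continuousWithinAt)
    (Continuous.continuousOn (by fun_prop)) (fun y _ _ => ?_)
    (fun t ht => (hl t ht).trans (hge t ht.2)) (fun t ht => (hr t ht).trans (hge t ht.2))
    (fun t ht y hy hlt => ?_) T ⟨by linarith, le_rfl⟩ x hx hx'
  · simpa using this
  · have h1 := (H.le_psi hα hβ y hs.le).trans (psi_le hα hβ y s)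
    linarith
  · have ht0 : 0 < t := hs.trans ht.1
    refine H.not_touch hα hβ (z := (y, t)) (c := -ustar) ht0 (hreg t ht y hy) ?_
      (hasHeatOpAt_affine ustar k T _) (by simpa using hku)
    have h1 : ustar < u y t := (hge t ht.2).trans_lt hlt
    filter_upwards [(isOpen_lt continuous_const continuous_snd).mem_nhds
      (show (y, t) ∈ {q : ℝ × ℝ | 0 < q.2} from ht0),
      (H.continuousAt (q := (y, t)) ht0).eventually (lt_mem_nhds h1)] with q h2 h3
    rw [H.eq_one_of_lt hα hβ (le_of_lt h2) h3, one_mul]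
    exact neg_le_neg h3.le

/-- Strong maximum principle for the threshold `u*` on a rectangle. -/
lemma lt_of_le_rectangle (H : IsWeakSolution α β ustar u p) (hα : 0 < α) (hβ : 0 < β)
    {x₀ δ s t₀ ε : ℝ} (hδ : 0 < δ) (hs : 0 < s) (hst : s ≤ t₀) (hε : 0 < ε) (hε' : ε ≤ ustar)
    (hle : ∀ x t, |x - x₀| ≤ δ → t ∈ Icc s t₀ → u x t ≤ ustar)
    (hbot : ∀ x, |x - x₀| ≤ δ → u x s ≤ ustar - ε)
    (hreg : ∀ t ∈ Ioc s t₀, ∀ x, |x - x₀| < δ →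
      α * Real.sqrt t < x ∨ |x| < α * Real.sqrt t) : u x₀ t₀ < ustar := by
  set k := Real.pi / (2 * δ) with hk
  have hk0 : 0 < k := by have := Real.pi_pos; positivity
  have hkδ : k * δ = Real.pi / 2 := by rw [hk]; field_simp
  have hexp : ∀ t ≥ s, Real.exp (-((k ^ 2 + 1) * (t - s))) ≤ 1 := fun t ht =>
    Real.exp_le_one_iff.2 (neg_nonpos.2 (mul_nonneg (by positivity) (sub_nonneg.2 ht)))
  have := parabolic_comparison (F := u)
    (h := fun x t => ustar - ε * Real.exp (-((k ^ 2 + 1) * (t - s))) * Real.cos (k * (x - x₀)))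
    (lo := fun _ => x₀ - δ) (hi := fun _ => x₀ + δ) (s := s) (T := t₀)
    continuous_const continuous_const
    (fun q hq => (H.continuousAt (hs.trans_le hq.1.1)).continuousWithinAt)
    (Continuous.continuousOn (by fun_prop)) (fun x h1 h2 => ?_) (fun t ht => ?_)
    (fun t ht => ?_) (fun t ht y hy hlt => ?_) t₀ ⟨hst, le_rfl⟩ x₀
    (by linarith) (by linarith)
  · simp only [sub_self, mul_zero, Real.cos_zero, mul_one] at this
    have : 0 < ε * Real.exp (-((k ^ 2 + 1) * (t₀ - s))) := by positivity
    linarith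
  · have h3 := hbot x (abs_le.2 ⟨by linarith, by linarith⟩)
    have h4 := mul_le_mul_of_nonneg_left (Real.cos_le_one (k * (x - x₀))) hε.le
    simp only [sub_self, mul_zero, neg_zero, Real.exp_zero, mul_one]
    linarith
  · have := hle (x₀ - δ) t (by simp [abs_of_pos hδ]) ht
    have e : k * (x₀ - δ - x₀) = -(Real.pi / 2) := by rw [← hkδ]; ring
    simpa only [e, Real.cos_neg, Real.cos_pi_div_two, mul_zero, sub_zero] using this
  · have := hle (x₀ + δ) t (by simp [abs_of_pos hδ]) ht
    have e : k * (x₀ + δ - x₀) = Real.pi / 2 := by rw [← hkδ]; ring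
    simpa only [e, Real.cos_pi_div_two, mul_zero, sub_zero] using this
  · have ht0 : 0 < t := hs.trans ht.1
    have hcos : 0 < Real.cos (k * (y - x₀)) := by
      refine Real.cos_pos_of_mem_Ioo ⟨?_, ?_⟩
      · rw [← hkδ]; nlinarith [hy.1]
      · rw [← hkδ]; nlinarith [hy.2]
    refine H.not_touch hα hβ (z := (y, t)) (c := 0) ht0
      (hreg t ht y (abs_lt.2 ⟨by linarith [hy.1], by linarith [hy.2]⟩))
      (H.eventually_nonneg_absorption ht0 ?_)
      (hasHeatOpAt_cos ustar ε (k ^ 2 + 1) k s x₀ _) ?_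
    · have h1 := Real.cos_le_one (k * (y - x₀))
      have h2 : ε * Real.exp (-((k ^ 2 + 1) * (t - s))) * Real.cos (k * (y - x₀)) ≤ ε * 1 * 1 := by
        gcongr
        exact hexp t ht.1.le
      simp only at hlt ⊢
      linarith
    · simp only [add_sub_cancel_left, mul_one]
      positivity

lemma eq_zero_of_forall_lt (H : IsWeakSolution α β ustar u p) (hα : 0 < α) (hβ : 0 < β)
    (hu : 0 < ustar) {x t : ℝ} (hx : 0 < x) (ht : 0 ≤ t) (h : ∀ s ∈ Icc 0 t, u x s < ustar) :
    p x t = 0 := by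
  obtain ⟨X, hX, hψ⟩ := exists_psi_le hα hβ (half_pos hu)
  set s₀ := (x / X) ^ 2 with hs₀
  have hs₀0 : 0 < s₀ := by positivity
  have hsmall : ∀ s ∈ Icc 0 s₀, u x s ≤ ustar / 2 := by
    intro s hs
    refine (H.le_psi hα hβ x hs.1).trans (hψ x s ?_)
    rw [mul_comm, ← le_div_iff₀ hX]
    exact Real.sqrt_le_iff.2 ⟨by positivity, hs.2⟩
  obtain ⟨-, -, -, hp, -⟩ := id H
  refine (hp x t ht).1 ?_
  rcases le_total t s₀ with hts | hts
  · refine (csSup_le ((nonempty_Icc.2 ht).image _) ?_).trans_lt (half_lt_self hu)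
    rintro _ ⟨s, hs, rfl⟩
    exact hsmall s ⟨hs.1, hs.2.trans hts⟩
  · obtain ⟨m, hm, hmax⟩ := (isCompact_Icc (a := s₀) (b := t)).exists_isMaxOn
      (nonempty_Icc.2 hts) (f := fun s => u x s) fun s hs =>
        (ContinuousAt.comp (f := fun s : ℝ => (x, s)) (x := s)
          (H.continuousAt (q := (x, s)) (hs₀0.trans_le hs.1))
          (by fun_prop)).continuousWithinAt
    have : max (ustar / 2) (u x m) < ustar :=
      max_lt (half_lt_self hu) (h m ⟨hs₀0.le.trans hm.1, hm.2⟩)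
    refine (csSup_le ((nonempty_Icc.2 ht).image _) ?_).trans_lt this
    rintro _ ⟨s, hs, rfl⟩
    rcases le_total s s₀ with hss | hss
    · exact le_max_of_le_left (hsmall s ⟨hs.1, hss⟩)
    · exact le_max_of_le_right (hmax ⟨hss, hs.2⟩)


lemma exists_forall_lt_outside_parabola (H : IsWeakSolution α β ustar u p) (hα : 0 < α)
    (hβ : 0 < β) (hu : 0 < ustar) {η t₀ : ℝ} (hη : α ≤ η)
    (h : ∀ t ≥ t₀, u (η * Real.sqrt t) t ≤ ustar) :
    ∃ z ≥ (0 : ℝ), ∀ x t, z < x → 0 < t → η * Real.sqrt t < x → u x t < ustar := by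
  obtain ⟨X, hX, hψ⟩ := exists_psi_le hα hβ hu
  obtain ⟨Y, hY, hψ'⟩ := exists_psi_le hα hβ (half_pos hu)
  have hη0 : 0 < η := hα.trans_le hη
  set s := max t₀ 1 with hs
  have hs0 : 0 < s := zero_lt_one.trans_le (le_max_right _ _)
  set t₁ := s + (α * β / 2) * Real.exp (α ^ 2 / 4) * gaussTail α / ustar + 1 with ht₁
  have hle : ∀ x t, X * Real.sqrt t₁ ≤ x → 0 < t → η * Real.sqrt t ≤ x → u x t ≤ ustar := by
    intro x t hx ht hxt
    rcases le_total t t₁ with htt | htt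
    · exact (H.le_psi hα hβ x ht.le).trans (hψ x t
        ((mul_le_mul_of_nonneg_left (Real.sqrt_le_sqrt htt) hX.le).trans hx))
    · refine H.le_of_le_boundary hα hβ hu (lo := fun r => η * Real.sqrt r)
        (hi := fun _ => max (X * Real.sqrt t) x) hs0 (by linarith) (by fun_prop)
        continuous_const (fun r hr => h r ((le_max_left _ _).trans hr.1)) (fun r hr => ?_)
        (fun r _ y hy => Or.inl ?_) hxt (le_max_right _ _)
      · exact (H.le_psi hα hβ _ (hs0.le.trans hr.1)).trans (hψ _ r
          ((mul_le_mul_of_nonneg_left (Real.sqrt_le_sqrt hr.2) hX.le).trans (le_max_left _ _)))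
      · exact (mul_le_mul_of_nonneg_right hη (Real.sqrt_nonneg r)).trans_lt hy.1
  refine ⟨X * Real.sqrt t₁, by positivity, fun x t hx ht hxt => ?_⟩
  set m := max (X * Real.sqrt t₁) (η * Real.sqrt t) with hm
  have hmx : m < x := max_lt hx hxt
  have hm0 : 0 ≤ m := le_max_of_le_left (by positivity)
  set δ := (x - m) / 2 with hδ
  have hδ0 : 0 < δ := by linarith
  have hxδ : m < x - δ := by linarith
  have hm1 : X * Real.sqrt t₁ ≤ m := le_max_left _ _
  have hm2 : η * Real.sqrt t ≤ m := le_max_right _ _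
  have hr0 : 0 < min t (((x - δ) / Y) ^ 2) := by
    have : 0 < x - δ := by linarith
    positivity
  have hside : ∀ y, |y - x| ≤ δ → x - δ ≤ y := fun y hy => by linarith [(abs_le.1 hy).1]
  have hpar : ∀ r ≤ t, η * Real.sqrt r ≤ m := fun r hr =>
    (mul_le_mul_of_nonneg_left (Real.sqrt_le_sqrt hr) hη0.le).trans hm2
  refine H.lt_of_le_rectangle hα hβ hδ0 hr0 (min_le_left _ _) (half_pos hu) (by linarith)
    (fun y r hy hr => hle y r ?_ (hr0.trans_le hr.1) ?_) (fun y hy => ?_)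
    (fun r hr y hy => Or.inl ?_)
  · linarith [hside y hy]
  · linarith [hside y hy, hpar r hr.2]
  · rw [sub_half]
    refine (H.le_psi hα hβ y hr0.le).trans (hψ' y _ (le_trans ?_ (hside y hy)))
    rw [mul_comm, ← le_div_iff₀ hY]
    exact Real.sqrt_le_iff.2 ⟨div_nonneg (by linarith) hY.le, min_le_right _ _⟩
  · have := mul_le_mul_of_nonneg_right hη (Real.sqrt_nonneg r)
    linarith [hside y hy.le, hpar r hr.2]

lemma exists_forall_le_inside_parabola (H : IsWeakSolution α β ustar u p) (hα : 0 < α)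
    (hβ : 0 < β) (hu : 0 < ustar) {t₀ : ℝ} (h : ∀ t ≥ t₀, u (α * Real.sqrt t) t ≤ ustar) :
    ∃ t₁ : ℝ, t₀ < t₁ ∧ 0 < t₁ ∧
      ∀ t ≥ t₁, ∀ x, |x| ≤ α * Real.sqrt t → u x t ≤ ustar := by
  have hM0 : 0 ≤ (α * β / 2) * Real.exp (α ^ 2 / 4) * gaussTail α :=
    (psi_nonneg hα hβ 0 0).trans (psi_le hα hβ 0 0)
  have hM1 : 0 ≤ (α * β / 2) * Real.exp (α ^ 2 / 4) * gaussTail α / ustar :=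
    div_nonneg hM0 hu.le
  set s := max t₀ 1 with hs
  have hs0 : 0 < s := zero_lt_one.trans_le (le_max_right _ _)
  have hs1 : t₀ ≤ s := le_max_left _ _
  refine ⟨s + (α * β / 2) * Real.exp (α ^ 2 / 4) * gaussTail α / ustar + 1, by linarith,
    by linarith, fun t ht x hx => ?_⟩
  refine H.le_of_le_boundary hα hβ hu (lo := fun r => -(α * Real.sqrt r))
    (hi := fun r => α * Real.sqrt r) hs0 (by linarith) (by fun_prop) (by fun_prop)
    (fun r hr => ?_) (fun r hr => h r (hs1.trans hr.1))
    (fun r _ y hy => Or.inr (abs_lt.2 hy)) (abs_le.1 hx).1 (abs_le.1 hx).2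
  rw [H.1]
  exact h r (hs1.trans hr.1)

lemma exists_forall_lt_of_lt_parabola (H : IsWeakSolution α β ustar u p) (hα : 0 < α)
    (hβ : 0 < β) (hu : 0 < ustar) {t₀ : ℝ} (h : ∀ t ≥ t₀, u (α * Real.sqrt t) t < ustar) :
    ∃ z > (0 : ℝ), ∀ x ≥ z, ∀ t ≥ (0 : ℝ), u x t < ustar := by
  obtain ⟨z, hz, hout⟩ :=
    H.exists_forall_lt_outside_parabola hα hβ hu le_rfl fun t ht => (h t ht).le
  obtain ⟨t₁, ht₀, ht₁, hin⟩ :=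
    H.exists_forall_le_inside_parabola hα hβ hu fun t ht => (h t ht).le
  refine ⟨max z (α * Real.sqrt t₁) + 1, by positivity, fun x hx t ht => ?_⟩
  have hxz : z < x := by linarith [le_max_left z (α * Real.sqrt t₁)]
  have hxt₁ : α * Real.sqrt t₁ < x := by linarith [le_max_right z (α * Real.sqrt t₁)]
  have hx0 : 0 < x := hz.trans_lt hxz
  set s₀ := (x / α) ^ 2 with hs₀
  have hs₀0 : 0 < s₀ := by positivity
  have hsq : α * Real.sqrt s₀ = x := by
    rw [hs₀, Real.sqrt_sq (by positivity)]
    field_simp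
  have hts₀ : t₁ < s₀ := by
    rw [← hsq] at hxt₁
    exact (Real.sqrt_lt_sqrt_iff ht₁.le).1 (lt_of_mul_lt_mul_left hxt₁ hα.le)
  rcases ht.eq_or_lt with rfl | ht
  · exact (H.le_psi hα hβ x le_rfl).trans_lt (by rwa [psi_zero])
  rcases lt_trichotomy t s₀ with hts | rfl | hts
  · refine hout x t hxz ht ?_
    rw [← hsq]
    exact mul_lt_mul_of_pos_left (Real.sqrt_lt_sqrt ht.le hts) hα
  · have := h s₀ (ht₀.trans hts₀).le
    rwa [hsq] at this
  have h0 : u x s₀ < ustar := by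
    have := h s₀ (ht₀.trans hts₀).le
    rwa [hsq] at this
  set ε := min ((ustar - u x s₀) / 2) ustar with hε
  have hε0 : 0 < ε := lt_min (by linarith) hu
  have hε1 : ε ≤ (ustar - u x s₀) / 2 := min_le_left _ _
  obtain ⟨ρ, hρ, hnear⟩ := Metric.eventually_nhds_iff.1
    ((H.continuousAt (q := (x, s₀)) hs₀0).eventually
      (gt_mem_nhds (show u x s₀ < ustar - ε by linarith)))
  rcases lt_or_ge t (s₀ + ρ) with htρ | htρ
  · have := hnear (y := (x, t)) (by
      rw [Prod.dist_eq, dist_self, Real.dist_eq, abs_of_pos (sub_pos.2 hts)]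
      exact max_lt hρ (by linarith))
    simp only at this
    linarith
  have hs₁ : x < α * Real.sqrt (s₀ + ρ / 2) := by
    have := mul_lt_mul_of_pos_left (Real.sqrt_lt_sqrt hs₀0.le (by linarith : s₀ < s₀ + ρ / 2)) hα
    rwa [hsq] at this
  set δ := min (ρ / 2) (min ((α * Real.sqrt (s₀ + ρ / 2) - x) / 2) (x / 2)) with hδ
  have hδ0 : 0 < δ := lt_min (by linarith) (lt_min (by linarith) (by linarith))
  have hδ1 : δ ≤ ρ / 2 := min_le_left _ _
  have hδ2 : δ ≤ (α * Real.sqrt (s₀ + ρ / 2) - x) / 2 :=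
    (min_le_right _ _).trans (min_le_left _ _)
  have hδ3 : δ ≤ x / 2 := (min_le_right _ _).trans (min_le_right _ _)
  have habs : ∀ y r, |y - x| ≤ δ → s₀ + ρ / 2 ≤ r → |y| < α * Real.sqrt r := by
    intro y r hy hr
    have h1 := mul_le_mul_of_nonneg_left (Real.sqrt_le_sqrt hr) hα.le
    have h2 := abs_le.1 hy
    exact abs_lt.2 ⟨by linarith, by linarith⟩
  refine H.lt_of_le_rectangle hα hβ hδ0 (by linarith : 0 < s₀ + ρ / 2) (by linarith) hε0
    (min_le_right _ _) (fun y r hy hr => ?_) (fun y hy => ?_)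
    (fun r hr y hy => Or.inr (habs y r hy.le hr.1.le))
  · exact hin r (by linarith [hr.1]) y (habs y r hy hr.1).le
  · refine (hnear (y := (y, s₀ + ρ / 2)) ?_).le
    rw [Prod.dist_eq, Real.dist_eq, Real.dist_eq]
    refine max_lt (by simp only; linarith) ?_
    rw [add_sub_cancel_left, abs_of_pos (by linarith)]
    linarith

end IsWeakSolution

lemma lt_of_mem_interior_parabola {η z : ℝ} (hη : 0 < η) (hz : 0 ≤ z) {q : ℝ × ℝ}
    (hq : q ∈ interior {q : ℝ × ℝ | z ≤ q.1 ∧ 0 ≤ q.2 ∧ q.2 ≤ q.1 ^ 2 / η ^ 2}) :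
    z < q.1 ∧ 0 < q.2 ∧ η * Real.sqrt q.2 < q.1 := by
  obtain ⟨r, hr, hball⟩ := Metric.mem_nhds_iff.1 (mem_interior_iff_mem_nhds.1 hq)
  have hmem : ∀ a b : ℝ, |a| < r → |b| < r → z ≤ q.1 + a ∧ 0 ≤ q.2 + b ∧
      q.2 + b ≤ (q.1 + a) ^ 2 / η ^ 2 := fun a b ha hb => by
    refine hball (show (q.1 + a, q.2 + b) ∈ Metric.ball q r from ?_)
    rw [Metric.mem_ball, Prod.dist_eq, Real.dist_eq, Real.dist_eq]
    simpa using ⟨ha, hb⟩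
  have hr1 : |(-(r / 2))| < r := by rw [abs_neg, abs_of_pos (by linarith)]; linarith
  have hr2 : |r / 2| < r := by rw [abs_of_pos (by linarith)]; linarith
  have hr3 : |(0 : ℝ)| < r := by simpa using hr
  have h1 := (hmem _ 0 hr1 hr3).1
  have h2 := (hmem 0 _ hr3 hr1).2.1
  have h3 := (hmem 0 _ hr3 hr2).2.2
  refine ⟨by linarith, by linarith, ?_⟩
  have hq1 : 0 < q.1 := by linarith
  rw [mul_comm, ← lt_div_iff₀ hη]
  refine (Real.sqrt_lt' (by positivity)).2 ?_
  rw [div_pow]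
  rw [add_zero] at h3
  linarith

/-- (a) if `u(η√t, t) ≤ u*` for all `t ≥ t₀` with `η ≥ α`, then
`u < u*` and `p = 0` in the interior of the region `D_{η,z} = {x ≥ z, 0 ≤ t ≤ x²/η²}`
for some `z ≥ 0`; (b) if `η = α` and the inequality is strict, then `u < u*` and `p = 0`
on `{x ≥ z} × [0,∞)` for some `z ≥ 0`. -/
theorem no_precipitation_beyond_parabola (α β ustar : ℝ) (hα : 0 < α) (hβ : 0 < β)
    (hu : 0 < ustar)
    (u p : ℝ → ℝ → ℝ) (hsol : IsWeakSolution α β ustar u p) :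
    (∀ η t₀ : ℝ, α ≤ η → 0 ≤ t₀ →
      (∀ t ≥ t₀, u (η * Real.sqrt t) t ≤ ustar) →
      ∃ z ≥ (0:ℝ), ∀ q ∈ interior {q : ℝ × ℝ | z ≤ q.1 ∧ 0 ≤ q.2 ∧ q.2 ≤ q.1 ^ 2 / η ^ 2},
        u q.1 q.2 < ustar ∧ p q.1 q.2 = 0) ∧
    (∀ t₀ : ℝ, 0 ≤ t₀ →
      (∀ t ≥ t₀, u (α * Real.sqrt t) t < ustar) →
      ∃ z ≥ (0:ℝ), ∀ x ≥ z, ∀ t ≥ (0:ℝ), u x t < ustar ∧ p x t = 0) := by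
  refine ⟨fun η t₀ hη _ h => ?_, fun t₀ _ h => ?_⟩
  · obtain ⟨z, hz, hlt⟩ := hsol.exists_forall_lt_outside_parabola hα hβ hu hη h
    have hη0 : 0 < η := hα.trans_le hη
    refine ⟨z, hz, fun q hq => ?_⟩
    obtain ⟨h1, h2, h3⟩ := lt_of_mem_interior_parabola hη0 hz hq
    have hx : 0 < q.1 := hz.trans_lt h1
    refine ⟨hlt _ _ h1 h2 h3, hsol.eq_zero_of_forall_lt hα hβ hu hx h2.le fun s hs => ?_⟩
    rcases hs.1.eq_or_lt with rfl | hs0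
    · exact (hsol.le_psi hα hβ _ le_rfl).trans_lt (by rwa [psi_zero])
    · exact hlt _ _ h1 hs0
        ((mul_le_mul_of_nonneg_left (Real.sqrt_le_sqrt hs.2) hη0.le).trans_lt h3)
  · obtain ⟨z, hz, hlt⟩ := hsol.exists_forall_lt_of_lt_parabola hα hβ hu h
    exact ⟨z, hz.le, fun x hx t ht => ⟨hlt x hx t ht,
      hsol.eq_zero_of_forall_lt hα hβ hu (hz.trans_le hx) ht fun s hs => hlt x hx s hs.1⟩⟩

end
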